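/- arXiv:1003.2792 — 2 statements merged into one kernel-verified Lean document; each statement's English description precedes it below -/
import Mathlib

section
/- Let q = p^e > 7 be an odd prime power with p prime. Then PSL₂(q) admits an unmixed Beauville structure of type ((p, p, (q−1)/2), ((q+1)/2, (q+1)/2, (q+1)/2)) and an unmixed Beauville structure of type ((p, p, (q+1)/2), ((q−1)/2, (q−1)/2, (q−1)/2)). -/
open Matrix

/-- The projective special linear group `PSL₂(F) = SL(2, F) / Z(SL(2, F))`. -/
abbrev PSL2 (F : Type*) [Field F] :=
  Matrix.SpecialLinearGroup (Fin 2) F ⧸ Subgroup.center (Matrix.SpecialLinearGroup (Fin 2) F)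

/-- `Σ(a)`: the union of the conjugacy classes of all powers of `a`. -/
def conjPowers {G : Type*} [Group G] (a : G) : Set G :=
  {x | ∃ (g : G) (j : ℕ), x = g * a ^ j * g⁻¹}

/-- `Σ(a, b, c)`: the union of the conjugacy classes of all powers of `a`, of `b`, and
of `c`. -/
def sigma3 {G : Type*} [Group G] (a b c : G) : Set G :=
  conjPowers a ∪ conjPowers b ∪ conjPowers c

/-- An unmixed Beauville structure for a group `G`: two triples, each with product `1` and
generating `G`, whose `Σ`-sets intersect trivially. -/
def IsUnmixedBeauville {G : Type*} [Group G] (a₁ b₁ c₁ a₂ b₂ c₂ : G) : Prop :=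
  a₁ * b₁ * c₁ = 1 ∧ a₂ * b₂ * c₂ = 1 ∧
  Subgroup.closure ({a₁, b₁} : Set G) = ⊤ ∧ Subgroup.closure ({a₂, b₂} : Set G) = ⊤ ∧
  sigma3 a₁ b₁ c₁ ∩ sigma3 a₂ b₂ c₂ = {1}

/-- `G` admits an unmixed Beauville structure of type `((r₁,s₁,t₁),(r₂,s₂,t₂))`. -/
def HasBeauvilleOfType (G : Type*) [Group G] (r₁ s₁ t₁ r₂ s₂ t₂ : ℕ) : Prop :=
  ∃ a₁ b₁ c₁ a₂ b₂ c₂ : G, IsUnmixedBeauville a₁ b₁ c₁ a₂ b₂ c₂ ∧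
    orderOf a₁ = r₁ ∧ orderOf b₁ = s₁ ∧ orderOf c₁ = t₁ ∧
    orderOf a₂ = r₂ ∧ orderOf b₂ = s₂ ∧ orderOf c₂ = t₂

open MulAction
open scoped LinearAlgebra.Projectivization MatrixGroups

theorem exists_sum_eq_orbit_add {G X : Type*} [Group G] [MulAction G X] [Finite X]
    {f : X → ℤ} (hf : ∀ (g : G) x, f (g • x) = f x) {Y : Finset X}
    (hY : ∀ (g : G), ∀ y ∈ Y, g • y ∈ Y) {x : X} (hx : x ∈ Y) :
    ∃ Z ⊆ Y, (∀ (g : G), ∀ y ∈ Z, g • y ∈ Z) ∧ (∀ y ∈ Y, y ∉ orbit G x → y ∈ Z) ∧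
      ∑ y ∈ Y, f y = Nat.card (orbit G x) * f x + ∑ y ∈ Z, f y := by
  classical
  have := Fintype.ofFinite X
  refine ⟨Y.filter (· ∉ orbit G x), Finset.filter_subset _ _, ?_, ?_, ?_⟩
  · intro g y hy
    rw [Finset.mem_filter] at hy ⊢
    refine ⟨hY g y hy.1, fun h => hy.2 ?_⟩
    obtain ⟨g', hg'⟩ := h
    exact ⟨g⁻¹ * g', by simp [mul_smul, hg']⟩
  · intro y hy hne
    rw [Finset.mem_filter]
    exact ⟨hy, hne⟩
  · rw [← Finset.sum_filter_add_sum_filter_not Y (· ∈ orbit G x)]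
    congr 1
    have h1 : ∀ y ∈ Y.filter (· ∈ orbit G x), f y = f x := by
      intro y hy
      obtain ⟨g, rfl⟩ := (Finset.mem_filter.1 hy).2
      exact hf g x
    rw [Finset.sum_congr rfl h1, Finset.sum_const, nsmul_eq_mul]
    congr 2
    have h2 : Y.filter (· ∈ orbit G x) = (orbit G x).toFinset := by
      ext y
      simp only [Finset.mem_filter, Set.mem_toFinset, and_iff_right_iff_imp]
      rintro ⟨g, rfl⟩
      exact hY g x hx
    rw [h2, Set.toFinset_card, Nat.card_eq_fintype_card]

theorem three_orbits_tame {h o₀ o₁ o₂ k₀ k₁ k₂ : ℕ} (h₀ : o₀ * k₀ = h) (h₁ : o₁ * k₁ = h)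
    (h₂ : o₂ * k₂ = h) (ho : 3 ≤ o₀) (hk₀ : 4 ≤ k₀) (hk₁ : 2 ≤ k₁) (hk : k₁ ≤ k₂)
    (hsum : o₀ + o₁ + o₂ = h + 2) : (k₀ = 4 ∧ h = 24) ∨ (k₀ = 5 ∧ h = 60) := by
  have e0 : 4 * o₀ ≤ h := by nlinarith
  obtain rfl | h3 := hk₁.eq_or_lt
  · obtain rfl | h4 := hk.eq_or_lt
    · omega
    · obtain rfl | h5 := h4.nat_succ_le.eq_or_lt
      · have : k₀ < 6 := by
          by_contra! hc
          have : 6 * o₀ ≤ h := by nlinarith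
          omega
        interval_cases k₀ <;> omega
      · have : 4 * o₂ ≤ h := by
          have : 4 ≤ k₂ := h5
          nlinarith
        omega
  · have : 3 * o₁ ≤ h := by nlinarith
    have : 3 ≤ k₂ := by omega
    have : 3 * o₂ ≤ h := by nlinarith
    omega

theorem two_orbits_wild {h q o₀ o k₀ k m : ℕ} (h₀ : o₀ * k₀ = h) (h₁ : o * (m * k) = h)
    (ho : 3 ≤ o₀) (hk₀ : 4 ≤ k₀) (hm : 3 ≤ m) (hodd : Odd m) (hkm : k + 1 ≤ m) (hmq : 3 * m ≤ q)
    (hq : q ≤ 2 * k₀ + 1) (hsum : (o₀ : ℤ) = 2 + o * (m - 2)) :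
    (k₀ = 4 ∧ h = 24) ∨ (k₀ = 5 ∧ h = 60) := by
  obtain ⟨n, rfl⟩ := Nat.exists_eq_add_of_le hm
  have hs : o₀ = 2 + o * (n + 1) := by
    push_cast at hsum
    zify
    linarith
  have ho' : 0 < o := by
    rcases Nat.eq_zero_or_pos o with rfl | h
    · omega
    · exact h
  have e1 : o * (k₀ * (n + 1)) < o * ((3 + n) * k) := by
    have : o * ((3 + n) * k) = (2 + o * (n + 1)) * k₀ := by rw [← hs, h₀, h₁]
    nlinarith
  have e2 : k₀ * (n + 1) < (3 + n) * k := lt_of_mul_lt_mul_left e1 (Nat.zero_le o)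
  have hn : n ≤ 1 := by
    by_contra! hc
    have : 3 * (3 + n) ≤ 2 * k₀ + 1 := by omega
    have hk : k ≤ n + 2 := by omega
    nlinarith
  have hn0 : n = 0 := by
    interval_cases n
    · rfl
    · revert hodd; decide
  subst hn0
  have hk2 : k = 2 := by omega
  subst hk2
  have : k₀ < 6 := by omega
  interval_cases k₀ <;> omega

theorem card_eq_of_sum_orbits {G X : Type*} [Group G] [MulAction G X] [Fintype X]
    {h q : ℕ} (hh : 0 < h) {m k : X → ℕ} (hminv : ∀ (g : G) (x : X), m (g • x) = m x)
    (hcard : ∀ x, Nat.card (orbit G x) * (m x * k x) = h)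
    (horb : ∀ x : X, 3 ≤ Nat.card (orbit G x))
    (hsum : ∑ x, ((m x * k x + m x : ℤ) - 2) = 2 * h - 2)
    (hm : ∀ x, m x = 1 ∨ (3 ≤ m x ∧ Odd (m x) ∧ k x + 1 ≤ m x ∧ 3 * m x ≤ q))
    {P : X} (hmP : m P = 1) (hkP : 4 ≤ k P) (hq : q ≤ 2 * k P + 1) :
    (k P = 4 ∧ h = 24) ∨ (k P = 5 ∧ h = 60) := by
  set f : X → ℤ := fun x => (m x * k x + m x : ℤ) - 2 with hf
  have horbinv : ∀ (g : G) (x : X), orbit G (g • x) = orbit G x :=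
    fun g x => orbit_eq_iff.2 ⟨g, rfl⟩
  have hmk : ∀ (g : G) x, m (g • x) * k (g • x) = m x * k x := by
    intro g x
    have h1 := hcard (g • x)
    rw [horbinv, ← hcard x] at h1
    exact Nat.eq_of_mul_eq_mul_left (by have := horb x; omega) h1
  have hfinv : ∀ (g : G) x, f (g • x) = f x := by
    intro g x
    have h1 := hmk g x
    simp only [hf, hminv]
    rw [hminv] at h1
    zify at h1
    rw [h1]
  have hkpos : ∀ x, 1 ≤ k x := by
    intro x
    rcases Nat.eq_zero_or_pos (k x) with h0 | h0
    · have := hcard x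
      rw [h0] at this
      simp at this
      omega
    · exact h0
  have hnn : ∀ x, 0 ≤ f x := by
    intro x
    have h1 := hkpos x
    have h2 : 1 ≤ m x := by rcases hm x with h | h <;> omega
    simp only [hf]
    have : (1 : ℤ) ≤ m x * k x := by exact_mod_cast Nat.mul_pos h2 h1
    have : (1 : ℤ) ≤ m x := by exact_mod_cast h2
    linarith
  have hcont : ∀ x, (Nat.card (orbit G x) : ℤ) * f x = h + Nat.card (orbit G x) * (m x - 2) := by
    intro x
    simp only [hf]
    have := hcard x
    zify at this
    linear_combination this
  have hlower : ∀ x, 0 < f x → (h : ℤ) ≤ 2 * (Nat.card (orbit G x) * f x) := by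
    intro x hx
    rw [hcont]
    have hc := hcard x
    have ho := horb x
    rcases hm x with h1 | h1
    · have : 2 ≤ k x := by
        simp only [hf, h1] at hx
        push_cast at hx
        have : (1 : ℤ) < k x := by linarith
        exact_mod_cast this
      rw [h1, one_mul] at hc
      have h2 : Nat.card (orbit G x) * 2 ≤ h := by nlinarith
      zify at h2
      rw [h1]
      push_cast
      linarith
    · have h2 : (3 : ℤ) ≤ m x := by exact_mod_cast h1.1
      have : (0 : ℤ) ≤ Nat.card (orbit G x) * (m x - 2) := by
        apply mul_nonneg <;> linarith
      linarith
  have hex : ∀ Y : Finset X, 0 < ∑ y ∈ Y, f y → ∃ y ∈ Y, 0 < f y := by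
    intro Y hY
    by_contra! hc
    have : ∑ y ∈ Y, f y ≤ 0 := Finset.sum_nonpos hc
    omega
  have hlow : ∀ Y : Finset X, (∀ (g : G), ∀ y ∈ Y, g • y ∈ Y) → 0 < ∑ y ∈ Y, f y →
      (h : ℤ) ≤ 2 * ∑ y ∈ Y, f y := by
    intro Y hY hpos
    obtain ⟨y, hy, hfy⟩ := hex Y hpos
    obtain ⟨Z, -, -, -, hZ⟩ := exists_sum_eq_orbit_add hfinv hY hy
    have h1 := hlower y hfy
    have h2 : 0 ≤ ∑ y ∈ Z, f y := Finset.sum_nonneg fun y _ => hnn y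
    rw [hZ]
    linarith
  have hP := hcard P
  have hoP := horb P
  rw [hmP, one_mul] at hP
  have h4 : 4 * Nat.card (orbit G P) ≤ h := by nlinarith
  obtain ⟨Y, -, hYinv, hYmem, hYsum⟩ := exists_sum_eq_orbit_add hfinv (Y := Finset.univ)
    (fun _ _ _ => Finset.mem_univ _) (Finset.mem_univ P)
  rw [hcont, hmP, hsum] at hYsum
  by_cases hwild : ∃ x, m x ≠ 1
  · obtain ⟨x, hx⟩ := hwild
    obtain ⟨hx1, hx2, hx3, hx4⟩ := (hm x).resolve_left hx
    have hxY : x ∈ Y := by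
      apply hYmem x (Finset.mem_univ x)
      rintro ⟨g, rfl⟩
      exact hx ((hminv g P).trans hmP)
    obtain ⟨Z, -, hZinv, -, hZsum⟩ := exists_sum_eq_orbit_add hfinv hYinv hxY
    rw [hcont] at hZsum
    have h2 : 0 ≤ ∑ y ∈ Z, f y := Finset.sum_nonneg fun y _ => hnn y
    have hx1' : (3 : ℤ) ≤ m x := by exact_mod_cast hx1
    have h5 : (0 : ℤ) ≤ Nat.card (orbit G x) * (m x - 2) := by
      apply mul_nonneg <;> linarith
    have h3 : ∑ y ∈ Z, f y = 0 := by
      by_contra hne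
      have := hlow Z hZinv (by omega)
      push_cast at *
      omega
    refine two_orbits_wild hP (hcard x) hoP hkP hx1 hx2 hx3 hx4 hq ?_
    push_cast at *
    linarith
  · push Not at hwild
    have h1 : 0 < ∑ y ∈ Y, f y := by push_cast at *; omega
    obtain ⟨x₁, hx₁, hf₁⟩ := hex Y h1
    obtain ⟨Z, -, hZinv, -, hZsum⟩ := exists_sum_eq_orbit_add hfinv hYinv hx₁
    rw [hcont, hwild] at hZsum
    have ho₁ := horb x₁
    have h2 : 0 < ∑ y ∈ Z, f y := by push_cast at *; omega
    obtain ⟨x₂, hx₂, hf₂⟩ := hex Z h2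
    obtain ⟨T, -, hTinv, -, hTsum⟩ := exists_sum_eq_orbit_add hfinv hZinv hx₂
    rw [hcont, hwild] at hTsum
    have hc₁ := hcard x₁
    have hc₂ := hcard x₂
    rw [hwild, one_mul] at hc₁ hc₂
    have hk2 : ∀ x, 0 < f x → 2 ≤ k x := by
      intro x hx
      simp only [hf, hwild] at hx
      push_cast at hx
      have : (1 : ℤ) < k x := by linarith
      exact_mod_cast this
    have hk₁ := hk2 _ hf₁
    have hk₂ := hk2 _ hf₂
    have h3 : 2 * Nat.card (orbit G x₁) ≤ h := by nlinarith
    have h5 : 2 * Nat.card (orbit G x₂) ≤ h := by nlinarith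
    have h6 : ∑ y ∈ T, f y = 0 := by
      by_contra hne
      have h7 : 0 ≤ ∑ y ∈ T, f y := Finset.sum_nonneg fun y _ => hnn y
      have := hlow T hTinv (by omega)
      push_cast at *
      omega
    rcases le_total (k x₁) (k x₂) with hle | hle
    · refine three_orbits_tame hP hc₁ hc₂ hoP hkP hk₁ hle ?_
      push_cast at *
      omega
    · refine three_orbits_tame hP hc₂ hc₁ hoP hkP hk₂ hle ?_
      push_cast at *
      omega

section Geometry

variable {K : Type*} [Field K]

theorem sl2_smul_eq_iff (g : SL(2, K)) (v w : Fin 2 → K) :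
    g • v = w ↔ g 0 0 * v 0 + g 0 1 * v 1 = w 0 ∧ g 1 0 * v 0 + g 1 1 * v 1 = w 1 := by
  rw [Matrix.SpecialLinearGroup.smul_def, funext_iff, Fin.forall_fin_two]
  simp [Matrix.mulVec, dotProduct, Fin.sum_univ_two]

theorem sl2_det (g : SL(2, K)) : g 0 0 * g 1 1 - g 0 1 * g 1 0 = 1 := by
  have := g.det_coe
  rwa [Matrix.det_fin_two] at this

theorem sl2_smul_smul_eq_iff (g : SL(2, K)) (v : Fin 2 → K) (a : K) :
    g • v = a • v ↔
      g 0 0 * v 0 + g 0 1 * v 1 = a * v 0 ∧ g 1 0 * v 0 + g 1 1 * v 1 = a * v 1 := by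
  simp [sl2_smul_eq_iff]

theorem sl2_eq_scalar_of_smul {g : SL(2, K)} {v w : Fin 2 → K} {a : K} (hv : g • v = a • v)
    (hw : g • w = a • w) (hvw : v 0 * w 1 - v 1 * w 0 ≠ 0) : g = 1 ∨ g = -1 := by
  rw [sl2_smul_smul_eq_iff] at hv hw
  have h00 : g 0 0 = a := by
    apply mul_left_cancel₀ hvw
    linear_combination w 1 * hv.1 - v 1 * hw.1
  have h01 : g 0 1 = 0 := by
    apply mul_left_cancel₀ hvw
    linear_combination v 0 * hw.1 - w 0 * hv.1
  have h10 : g 1 0 = 0 := by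
    apply mul_left_cancel₀ hvw
    linear_combination w 1 * hv.2 - v 1 * hw.2
  have h11 : g 1 1 = a := by
    apply mul_left_cancel₀ hvw
    linear_combination v 0 * hw.2 - w 0 * hv.2
  have ha : (a - 1) * (a + 1) = 0 := by
    have := sl2_det g
    rw [h00, h01, h11, h10] at this
    linear_combination this
  rcases mul_eq_zero.1 ha with h | h
  · left
    ext i j
    fin_cases i <;> fin_cases j <;> simp [h00, h01, h10, h11] <;> linear_combination h
  · right
    ext i j
    fin_cases i <;> fin_cases j <;> simp [h00, h01, h10, h11] <;> linear_combination h

theorem sl2_eigenvalue_mul {g : SL(2, K)} {v w : Fin 2 → K} {a b : K} (hv : g • v = a • v)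
    (hw : g • w = b • w) (hvw : v 0 * w 1 - v 1 * w 0 ≠ 0) : a * b = 1 := by
  rw [sl2_smul_smul_eq_iff] at hv hw
  apply mul_left_cancel₀ hvw
  have := sl2_det g
  linear_combination (v 0 * w 1 - v 1 * w 0) * this - hv.1 * b * w 1 + hv.2 * b * w 0
   - (g 0 0 * v 0 + g 0 1 * v 1) * hw.2 + (g 1 0 * v 0 + g 1 1 * v 1) * hw.1 

theorem projectivization_mk_eq_iff {v w : Fin 2 → K} (hv : v ≠ 0) (hw : w ≠ 0) :
    Projectivization.mk K v hv = Projectivization.mk K w hw ↔ v 0 * w 1 - v 1 * w 0 = 0 := by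
  rw [Projectivization.mk_eq_mk_iff']
  constructor
  · rintro ⟨a, rfl⟩
    simp
    ring
  · intro h
    by_cases h0 : w 0 = 0
    · have h1 : w 1 ≠ 0 := by
        intro h1
        apply hw
        ext i
        fin_cases i <;> simp [h0, h1]
      refine ⟨v 1 / w 1, ?_⟩
      ext i
      fin_cases i
      · simp only [h0, mul_zero, sub_zero, mul_eq_zero, h1, or_false] at h
        simp [h0, h]
      · simp [h1]
    · refine ⟨v 0 / w 0, ?_⟩
      ext i
      fin_cases i
      · simp [h0]
      · simp only [Fin.mk_one, Pi.smul_apply, smul_eq_mul]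
        field_simp
        linear_combination h

theorem sl2_smul_mk_eq_iff (g : SL(2, K)) {v : Fin 2 → K} (hv : v ≠ 0) :
    g • Projectivization.mk K v hv = Projectivization.mk K v hv ↔ ∃ a : K, g • v = a • v := by
  rw [Projectivization.smul_mk, Projectivization.mk_eq_mk_iff']
  simp only [eq_comm]

theorem sl2_eigenvalue_eq {g : SL(2, K)} {v : Fin 2 → K} (hv : v ≠ 0) {a : K}
    (h : g • v = a • v) : a * a - (g 0 0 + g 1 1) * a + 1 = 0 := by
  rw [sl2_smul_smul_eq_iff] at h
  have hd := sl2_det g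
  by_cases h0 : v 0 = 0
  · have h1 : v 1 ≠ 0 := by
      intro h1
      apply hv
      ext i
      fin_cases i <;> simp [h0, h1]
    apply mul_left_cancel₀ h1
    simp only [h0, mul_zero, zero_add] at h
    linear_combination - (a - g 0 0) * h.2 - v 1 * hd - g 1 0 * h.1
  · apply mul_left_cancel₀ h0
    linear_combination - (a - g 1 1) * h.1 - v 0 * hd - g 0 1 * h.2

theorem sl2_exists_eigenvector {g : SL(2, K)} {a : K}
    (h : a * a - (g 0 0 + g 1 1) * a + 1 = 0) : ∃ v : Fin 2 → K, v ≠ 0 ∧ g • v = a • v := by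
  have hd := sl2_det g
  have : ((g : Matrix (Fin 2) (Fin 2) K) - a • (1 : Matrix (Fin 2) (Fin 2) K)).det = 0 := by
    rw [Matrix.det_fin_two]
    simp
    linear_combination h + hd
  obtain ⟨v, hv, hgv⟩ := Matrix.exists_mulVec_eq_zero_iff.2 this
  refine ⟨v, hv, ?_⟩
  rw [Matrix.sub_mulVec, sub_eq_zero, Matrix.smul_mulVec, Matrix.one_mulVec] at hgv
  exact hgv

theorem sl2_smul_neg (v : Fin 2 → K) (g : SL(2, K)) : (-g) • v = -(g • v) := by
  rw [sl2_smul_eq_iff]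
  have := (sl2_smul_eq_iff g v _).1 rfl
  simp only [Matrix.SpecialLinearGroup.coe_neg, Matrix.neg_apply, Pi.neg_apply, ← this.1, ← this.2]
  constructor <;> ring

/-- A noncentral element of `SL₂(K)` with an eigenvalue in `K` fixes either two points of the
projective line, neither with eigenvalue `±1`, or one point, with eigenvalue `±1`. -/
theorem sl2_card_fixed_add_card [Finite K] {g : SL(2, K)} (h1 : g ≠ 1) (h2 : g ≠ -1) {a : K}
    (h : a * a - (g 0 0 + g 1 1) * a + 1 = 0) :
    Nat.card {x : ℙ K (Fin 2 → K) // g • x = x} +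
      Nat.card {x : ℙ K (Fin 2 → K) // g • x.rep = x.rep ∨ g • x.rep = -x.rep} = 2 := by
  obtain ⟨v, hv, hgv⟩ := sl2_exists_eigenvector h
  have ha : a ≠ 0 := by
    rintro rfl
    simp at h
  have hfix : ∀ x : ℙ K (Fin 2 → K), ∃ c : K, (g • x = x ↔ g • x.rep = c • x.rep) := by
    intro x
    by_cases hx : g • x = x
    · have := hx
      rw [← x.mk_rep, sl2_smul_mk_eq_iff] at this
      obtain ⟨c, hc⟩ := this
      exact ⟨c, by simp [hx, hc]⟩
    · refine ⟨1, ?_⟩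
      simp only [hx, false_iff]
      intro hc
      apply hx
      rw [← x.mk_rep, sl2_smul_mk_eq_iff]
      exact ⟨1, hc⟩
  have hpm : ∀ x : ℙ K (Fin 2 → K), g • x.rep = x.rep ∨ g • x.rep = -x.rep ↔
      ∃ c : K, c * c = 1 ∧ g • x.rep = c • x.rep := by
    intro x
    constructor
    · rintro (hx | hx)
      · exact ⟨1, by simp, by simpa using hx⟩
      · exact ⟨-1, by simp, by simpa using hx⟩
    · rintro ⟨c, hc, hx⟩
      rcases mul_self_eq_one_iff.1 hc with rfl | rfl
      · left; simpa using hx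
      · right; simpa using hx
  by_cases haa : a * a = 1
  · have key : ∀ (x : ℙ K (Fin 2 → K)) (c : K), g • x.rep = c • x.rep →
        x = Projectivization.mk K v hv := by
      intro x c hc
      by_contra hne
      rw [← x.mk_rep, projectivization_mk_eq_iff, ← neg_eq_zero] at hne
      have hne' : v 0 * x.rep 1 - v 1 * x.rep 0 ≠ 0 := fun h => hne (by linear_combination h)
      have hac := sl2_eigenvalue_mul hgv hc hne'
      have : c = a := mul_left_cancel₀ ha (hac.trans haa.symm)
      subst this
      rcases sl2_eq_scalar_of_smul hgv hc hne' with h | h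
      · exact h1 h
      · exact h2 h
    have hrep : ∃ c : K, c * c = 1 ∧ g • (Projectivization.mk K v hv).rep =
        c • (Projectivization.mk K v hv).rep := by
      obtain ⟨u, hu⟩ := Projectivization.exists_smul_eq_mk_rep K v hv
      refine ⟨a, haa, ?_⟩
      rw [← hu, smul_comm g u, hgv, smul_comm]
    have e1 : Nat.card {x : ℙ K (Fin 2 → K) // g • x = x} = 1 := by
      rw [Nat.card_eq_one_iff_exists]
      refine ⟨⟨_, (sl2_smul_mk_eq_iff g hv).2 ⟨a, hgv⟩⟩, ?_⟩
      rintro ⟨y, hy⟩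
      obtain ⟨c, hc⟩ := hfix y
      exact Subtype.ext (key y c (hc.1 hy))
    have e2 : Nat.card {x : ℙ K (Fin 2 → K) // g • x.rep = x.rep ∨ g • x.rep = -x.rep} = 1 := by
      rw [Nat.card_eq_one_iff_exists]
      refine ⟨⟨_, (hpm _).2 hrep⟩, ?_⟩
      rintro ⟨y, hy⟩
      obtain ⟨c, -, hc⟩ := (hpm y).1 hy
      exact Subtype.ext (key y c hc)
    rw [e1, e2]
  · have hb : a⁻¹ * a⁻¹ - (g 0 0 + g 1 1) * a⁻¹ + 1 = 0 := by
      field_simp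
      linear_combination h
    obtain ⟨w, hw, hgw⟩ := sl2_exists_eigenvector hb
    have hvw : v 0 * w 1 - v 1 * w 0 ≠ 0 := by
      intro hvw
      rw [← projectivization_mk_eq_iff hv hw, Projectivization.mk_eq_mk_iff'] at hvw
      obtain ⟨c, rfl⟩ := hvw
      rw [smul_comm, hgw, smul_comm c, ← sub_eq_zero, ← sub_smul, smul_eq_zero] at hgv
      have := hgv.resolve_right hv
      apply haa
      field_simp at this
      linear_combination -this
    have key : ∀ (x : ℙ K (Fin 2 → K)) (c : K), g • x.rep = c • x.rep →
        (x = Projectivization.mk K v hv ∧ c = a) ∨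
          (x = Projectivization.mk K w hw ∧ c = a⁻¹) := by
      intro x c hc
      by_cases hv' : v 0 * x.rep 1 - v 1 * x.rep 0 = 0
      · left
        have : Projectivization.mk K v hv = x := by
          rw [← x.mk_rep, projectivization_mk_eq_iff, hv']
        refine ⟨this.symm, ?_⟩
        obtain ⟨u, hu⟩ := Projectivization.exists_smul_eq_mk_rep K v hv
        rw [this] at hu
        rw [← hu, smul_comm g u, hgv, smul_comm c, ← sub_eq_zero, ← smul_sub, ← sub_smul,
          smul_eq_zero_iff_eq, smul_eq_zero] at hc
        have := hc.resolve_right hv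
        linear_combination -this
      · by_cases hw' : w 0 * x.rep 1 - w 1 * x.rep 0 = 0
        · right
          have : Projectivization.mk K w hw = x := by
            rw [← x.mk_rep, projectivization_mk_eq_iff, hw']
          refine ⟨this.symm, ?_⟩
          obtain ⟨u, hu⟩ := Projectivization.exists_smul_eq_mk_rep K w hw
          rw [this] at hu
          rw [← hu, smul_comm g u, hgw, smul_comm c, ← sub_eq_zero, ← smul_sub, ← sub_smul,
            smul_eq_zero_iff_eq, smul_eq_zero] at hc
          have := hc.resolve_right hw
          linear_combination -this
        · have i1 := sl2_eigenvalue_mul hgv hc hv'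
          have i2 := sl2_eigenvalue_mul hgw hc hw'
          exfalso
          apply haa
          have hc0 : c ≠ 0 := by
            rintro rfl
            simp at i1
          have : a = a⁻¹ := mul_right_cancel₀ hc0 (i1.trans i2.symm)
          nth_rewrite 2 [this]
          field_simp
    have e2 : Nat.card {x : ℙ K (Fin 2 → K) // g • x.rep = x.rep ∨ g • x.rep = -x.rep} = 0 := by
      rw [Nat.card_eq_zero]
      left
      constructor
      rintro ⟨y, hy⟩
      obtain ⟨c, hcc, hc⟩ := (hpm y).1 hy
      rcases key y c hc with ⟨-, rfl⟩ | ⟨-, rfl⟩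
      · exact haa hcc
      · apply haa
        field_simp at hcc
        linear_combination -hcc
    have e1 : Nat.card {x : ℙ K (Fin 2 → K) // g • x = x} = 2 := by
      rw [Nat.card_eq_two_iff]
      refine ⟨⟨_, (sl2_smul_mk_eq_iff g hv).2 ⟨a, hgv⟩⟩,
        ⟨_, (sl2_smul_mk_eq_iff g hw).2 ⟨a⁻¹, hgw⟩⟩, ?_, ?_⟩
      · rw [Ne, Subtype.mk_eq_mk, projectivization_mk_eq_iff]
        exact hvw
      · rw [Set.eq_univ_iff_forall]
        rintro ⟨y, hy⟩
        obtain ⟨c, hc⟩ := hfix y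
        rcases key y c (hc.1 hy) with ⟨h, -⟩ | ⟨h, -⟩
        · left; exact Subtype.ext h
        · right; exact Subtype.ext h
    rw [e1, e2]

end Geometry

section Stabilizers

variable {K : Type*} [Field K]

theorem sl2_exists_smul_single {v : Fin 2 → K} (hv : v ≠ 0) :
    ∃ s : SL(2, K), s • (![1, 0] : Fin 2 → K) = v := by
  have hco : IsCoprime (v 0) (v 1) := by
    by_cases h0 : v 0 = 0
    · have h1 : v 1 ≠ 0 := by
        intro h1
        apply hv
        ext i
        fin_cases i <;> simp [h0, h1]
      exact ⟨0, (v 1)⁻¹, by simp [h1]⟩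
    · exact ⟨(v 0)⁻¹, 0, by simp [h0]⟩
  obtain ⟨s, hs0, hs1⟩ := IsCoprime.exists_SL2_col hco 0
  refine ⟨s, ?_⟩
  rw [sl2_smul_eq_iff]
  simp [hs0, hs1]

theorem sl2_smul_of_commute {g u : SL(2, K)} (hgu : g * u = u * g) {v : Fin 2 → K} (hv : v ≠ 0)
    {a : K} (hg : g • v = a • v) (hu : u • v = v) (hu1 : u ≠ 1) : g • v = v ∨ g • v = -v := by
  obtain ⟨s, rfl⟩ := sl2_exists_smul_single hv
  have hg' : (s⁻¹ * g * s) • (![1, 0] : Fin 2 → K) = a • ![1, 0] := by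
    rw [mul_smul, mul_smul, hg, smul_comm, inv_smul_smul]
  have hu' : (s⁻¹ * u * s) • (![1, 0] : Fin 2 → K) = ![1, 0] := by
    rw [mul_smul, mul_smul, hu, inv_smul_smul]
  have hu1' : s⁻¹ * u * s ≠ 1 := by
    intro h
    apply hu1
    have : u = s * (s⁻¹ * u * s) * s⁻¹ := by group
    rw [this, h]
    simp
  have hcomm : (s⁻¹ * g * s) * (s⁻¹ * u * s) = (s⁻¹ * u * s) * (s⁻¹ * g * s) := by
    have h1 : (s⁻¹ * g * s) * (s⁻¹ * u * s) = s⁻¹ * (g * u) * s := by group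
    have h2 : (s⁻¹ * u * s) * (s⁻¹ * g * s) = s⁻¹ * (u * g) * s := by group
    rw [h1, h2, hgu]
  generalize s⁻¹ * g * s = g' at hg' hcomm
  generalize s⁻¹ * u * s = u' at hu' hu1' hcomm
  have dg := sl2_det g'
  have du := sl2_det u'
  rw [sl2_smul_smul_eq_iff] at hg'
  rw [sl2_smul_eq_iff] at hu'
  simp only [Matrix.cons_val_zero, Matrix.cons_val_one, mul_one, mul_zero, add_zero] at hg' hu'
  have h01 := congrArg (fun M : SL(2, K) => M 0 1) hcomm
  simp only [Matrix.SpecialLinearGroup.coe_mul, Matrix.mul_apply, Fin.sum_univ_two] at h01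
  rw [hg'.1, hg'.2] at dg
  rw [hu'.1, hu'.2] at du
  rw [hg'.1, hu'.1] at h01
  have hd : u' 1 1 = 1 := by linear_combination du
  have hb : u' 0 1 ≠ 0 := by
    intro hb
    apply hu1'
    ext i j
    fin_cases i <;> fin_cases j <;> simp [hu'.1, hu'.2, hd, hb]
  have h2 : a = g' 1 1 := by
    apply mul_left_cancel₀ hb
    rw [hd] at h01
    linear_combination h01
  rw [hg]
  have haa : a * a = 1 := by
    rw [← h2] at dg
    linear_combination dg
  rcases mul_self_eq_one_iff.1 haa with rfl | rfl
  · left; simp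
  · right; simp

variable (H : Subgroup SL(2, K))

/-- The elements of `H` acting as `±1` on the line spanned by `v`. -/
def signStabilizer (v : Fin 2 → K) : Subgroup H where
  carrier := {g | g • v = v ∨ g • v = -v}
  one_mem' := by simp
  mul_mem' := by
    rintro a b (ha | ha) (hb | hb) <;> simp [mul_smul, ha, hb]
  inv_mem' := by
    rintro a (ha | ha)
    · left; rw [inv_smul_eq_iff, ha]
    · right; rw [inv_smul_eq_iff, smul_neg, ha, neg_neg]

variable {H}

theorem signStabilizer_le_stabilizer (x : ℙ K (Fin 2 → K)) :
    signStabilizer H x.rep ≤ stabilizer H x := by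
  intro g hg
  rw [mem_stabilizer_iff, ← x.mk_rep, Subgroup.smul_def, sl2_smul_mk_eq_iff]
  rcases hg with h | h
  · exact ⟨1, by rw [one_smul]; exact h⟩
  · exact ⟨-1, by rw [neg_smul, one_smul]; exact h⟩

theorem card_signStabilizer [Finite H] (h2 : (2 : K) ≠ 0) (hneg : -1 ∈ H) {v : Fin 2 → K}
    (hv : v ≠ 0) : Nat.card (signStabilizer H v) = 2 * Nat.card (stabilizer H v) := by
  have e : (signStabilizer H v : Set H) =
      (stabilizer H v : Set H) ∪ (fun g => ⟨-1, hneg⟩ * g) '' (stabilizer H v : Set H) := by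
    ext g
    constructor
    · rintro (h | h)
      · left; exact h
      · right
        refine ⟨⟨-1, hneg⟩ * g, ?_, ?_⟩
        · rw [SetLike.mem_coe, mem_stabilizer_iff, mul_smul, h, Subgroup.smul_def, sl2_smul_neg,
            one_smul, neg_neg]
        · ext : 1
          simp
    · rintro (h | ⟨g', h, rfl⟩)
      · left; exact h
      · right
        rw [SetLike.mem_coe, mem_stabilizer_iff] at h
        change (_ * _ : H) • v = -v
        rw [mul_smul, h, Subgroup.smul_def, sl2_smul_neg, one_smul]
  have hdisj : Disjoint (stabilizer H v : Set H)
      ((fun g => ⟨-1, hneg⟩ * g) '' (stabilizer H v : Set H)) := by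
    rw [Set.disjoint_left]
    rintro _ h ⟨g, h', rfl⟩
    rw [SetLike.mem_coe, mem_stabilizer_iff] at h h'
    rw [mul_smul, h', Subgroup.smul_def, sl2_smul_neg, one_smul, neg_eq_iff_add_eq_zero,
      ← two_smul K, smul_eq_zero] at h
    exact h.elim h2 hv
  rw [← SetLike.coe_sort_coe, Nat.card_coe_set_eq, e,
    Set.ncard_union_eq hdisj (Set.toFinite _) (Set.toFinite _),
    Set.ncard_image_of_injective _ (mul_right_injective _), ← two_mul]
  rfl

theorem card_stabilizer_smul_rep (g : H) (x : ℙ K (Fin 2 → K)) :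
    Nat.card (stabilizer H (g • x).rep) = Nat.card (stabilizer H x.rep) := by
  have h1 : g • x =
      Projectivization.mk K (g • x.rep) ((smul_ne_zero_iff_ne g).2 x.rep_nonzero) := by
    conv_lhs => rw [← x.mk_rep]
    rfl
  obtain ⟨u, hu⟩ := Projectivization.exists_smul_eq_mk_rep K (g • x.rep)
    ((smul_ne_zero_iff_ne g).2 x.rep_nonzero)
  rw [← h1] at hu
  have h2 : stabilizer H (g • x).rep = stabilizer H (g • x.rep) := by
    ext t
    rw [mem_stabilizer_iff, mem_stabilizer_iff, ← hu, smul_comm t u]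
    exact smul_left_cancel_iff u
  rw [h2]
  exact Nat.card_congr (stabilizerEquivStabilizer (g := g) (a := x.rep) rfl).symm.toEquiv

theorem exists_smul_rep_of_smul_eq {g : H} {x : ℙ K (Fin 2 → K)} (hg : g • x = x) :
    ∃ a : K, g • x.rep = a • x.rep := by
  rwa [← x.mk_rep, Subgroup.smul_def, sl2_smul_mk_eq_iff] at hg

theorem card_stabilizer_le_mul [Finite H] {x : ℙ K (Fin 2 → K)}
    (hx : Nat.card (stabilizer H x.rep) ≠ 1) :
    Nat.card (stabilizer H x) ≤
      Nat.card (signStabilizer H x.rep) * (Nat.card (stabilizer H x.rep) - 1) := by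
  classical
  have := Fintype.ofFinite H
  obtain ⟨u, hu⟩ : ∃ u : stabilizer H x.rep, u ≠ 1 := by
    by_contra! hc
    exact hx (Nat.card_eq_one_iff_exists.2 ⟨1, fun y => hc y⟩)
  have hev : ∀ s : stabilizer H x, ∃ a : K, a ≠ 0 ∧ (s : H) • x.rep = a • x.rep := by
    intro s
    obtain ⟨a, ha⟩ := exists_smul_rep_of_smul_eq s.2
    refine ⟨a, ?_, ha⟩
    rintro rfl
    rw [zero_smul, smul_eq_zero_iff_eq] at ha
    exact x.rep_nonzero ha
  have hmem : ∀ s : stabilizer H x, (s : H) * u * (s : H)⁻¹ ∈ stabilizer H x.rep := by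
    intro s
    obtain ⟨a, ha0, ha⟩ := hev s
    have hu' := u.2
    rw [mem_stabilizer_iff] at hu' ⊢
    rw [mul_smul, mul_smul]
    have : (s : H)⁻¹ • x.rep = a⁻¹ • x.rep := by
      rw [inv_smul_eq_iff, smul_comm, ha, inv_smul_smul₀ ha0]
    rw [this, smul_comm (u : H), hu', smul_comm (s : H), ha, inv_smul_smul₀ ha0]
  let φ : stabilizer H x → stabilizer H x.rep := fun s => ⟨_, hmem s⟩
  have h := Finset.card_le_mul_card_image_of_maps_to (f := φ) (s := Finset.univ)
    (t := Finset.univ.erase 1) (n := Nat.card (signStabilizer H x.rep)) ?_ ?_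
  · rw [Finset.card_erase_of_mem (Finset.mem_univ _)] at h
    simpa [Nat.card_eq_fintype_card] using h
  · intro s _
    simp only [Finset.mem_erase, Finset.mem_univ, and_true, φ]
    intro h
    apply hu
    rw [Subtype.ext_iff] at h ⊢
    exact conj_eq_one_iff.1 h
  · intro t ht
    rcases Finset.eq_empty_or_nonempty {s ∈ Finset.univ | φ s = t} with he | ⟨s₀, hs₀⟩
    · rw [he]; simp
    · rw [Finset.mem_filter] at hs₀
      rw [Nat.card_eq_fintype_card, ← Finset.card_univ]
      have hin : ∀ s ∈ ({s ∈ Finset.univ | φ s = t} : Finset (stabilizer H x)),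
          (s₀ : H)⁻¹ * (s : H) ∈ signStabilizer H x.rep := by
        intro s hs
        rw [Finset.mem_filter] at hs
        have h1 : (s : H) * u * (s : H)⁻¹ = (s₀ : H) * u * (s₀ : H)⁻¹ :=
          congrArg Subtype.val (hs.2.trans hs₀.2.symm)
        have h2 : ((s₀ : H)⁻¹ * s) * u = u * ((s₀ : H)⁻¹ * s) := by
          calc ((s₀ : H)⁻¹ * s) * u = (s₀ : H)⁻¹ * ((s : H) * u * (s : H)⁻¹) * s := by group
            _ = _ := by rw [h1]; group
        obtain ⟨a, -, ha⟩ := hev (s₀⁻¹ * s)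
        have h3 : (u : H) ≠ 1 := fun h => hu (Subtype.ext h)
        exact sl2_smul_of_commute (g := (((s₀ : H)⁻¹ * s : H) : SL(2, K)))
          (u := ((u : H) : SL(2, K))) (congrArg Subtype.val h2) x.rep_nonzero ha u.2
          (fun h => h3 (Subtype.ext h))
      refine Finset.card_le_card_of_injOn (fun s => if hs : _ then ⟨(s₀ : H)⁻¹ * s, hs⟩ else 1)
        (fun _ _ => Finset.mem_univ _) ?_
      intro s hs s' hs' he
      simp only [hin s hs, hin s' hs', dite_true] at he
      have := congrArg Subtype.val he
      exact Subtype.ext (mul_left_cancel this)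

theorem sum_card_stabilizers [Fintype (ℙ K (Fin 2 → K))] [Finite K] (h2 : (2 : K) ≠ 0)
    (hneg : -1 ∈ H)
    (hev : ∀ g ∈ H, ∃ a : K, a * a - (g 0 0 + g 1 1) * a + 1 = 0) :
    ∑ x : ℙ K (Fin 2 → K),
      ((Nat.card (stabilizer H x) + Nat.card (signStabilizer H x.rep) : ℤ) - 4) =
        2 * (Nat.card H - 2) := by
  classical
  have := Fintype.ofFinite H
  have hne : (1 : SL(2, K)) ≠ -1 := by
    intro h
    have := congrArg (fun M : SL(2, K) => M 0 0) h
    simp at this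
    apply h2
    linear_combination this
  let m1 : H := ⟨-1, hneg⟩
  have hm1 : (1 : H) ≠ m1 := fun h => hne (congrArg Subtype.val h)
  let S : Finset H := {1, m1}
  have hS : S.card = 2 := Finset.card_pair hm1
  have h1 : ∀ x : ℙ K (Fin 2 → K), (Nat.card (stabilizer H x) : ℤ) - 2 =
      ∑ g ∈ Sᶜ, if g • x = x then 1 else 0 := by
    intro x
    have : (Nat.card (stabilizer H x) : ℤ) = ∑ g : H, if g • x = x then 1 else 0 := by
      rw [Finset.sum_boole, Nat.card_eq_fintype_card]
      norm_cast
      exact Fintype.card_subtype _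
    rw [this, ← Finset.sum_add_sum_compl S]
    have hm : ∀ g ∈ S, (if g • x = x then (1 : ℤ) else 0) = 1 := by
      intro g hg
      rw [if_pos]
      simp only [S, Finset.mem_insert, Finset.mem_singleton] at hg
      rcases hg with rfl | rfl
      · simp
      · refine signStabilizer_le_stabilizer x (Or.inr ?_)
        rw [Subgroup.smul_def, sl2_smul_neg, one_smul]
    rw [Finset.sum_congr rfl hm]
    simp [hS]
  have h3 : ∀ x : ℙ K (Fin 2 → K), (Nat.card (signStabilizer H x.rep) : ℤ) - 2 =
      ∑ g ∈ Sᶜ, if g • x.rep = x.rep ∨ g • x.rep = -x.rep then 1 else 0 := by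
    intro x
    have : (Nat.card (signStabilizer H x.rep) : ℤ) =
        ∑ g : H, if g • x.rep = x.rep ∨ g • x.rep = -x.rep then 1 else 0 := by
      rw [Finset.sum_boole, Nat.card_eq_fintype_card]
      norm_cast
      refine Fintype.card_of_subtype _ fun g => ?_
      rw [Finset.mem_filter]
      exact and_iff_right (Finset.mem_univ g)
    rw [this, ← Finset.sum_add_sum_compl S]
    have hm : ∀ g ∈ S, (if g • x.rep = x.rep ∨ g • x.rep = -x.rep then (1 : ℤ) else 0) = 1 := by
      intro g hg
      rw [if_pos]
      simp only [S, Finset.mem_insert, Finset.mem_singleton] at hg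
      rcases hg with rfl | rfl
      · simp
      · right
        rw [Subgroup.smul_def, sl2_smul_neg, one_smul]
    rw [Finset.sum_congr rfl hm]
    simp [hS]
  have h4 : ∀ x : ℙ K (Fin 2 → K),
      ((Nat.card (stabilizer H x) + Nat.card (signStabilizer H x.rep) : ℤ) - 4) =
      ∑ g ∈ Sᶜ, ((if g • x = x then 1 else 0) +
        if g • x.rep = x.rep ∨ g • x.rep = -x.rep then 1 else 0) := by
    intro x
    rw [Finset.sum_add_distrib, ← h1, ← h3]
    ring
  rw [Finset.sum_congr rfl fun x _ => h4 x, Finset.sum_comm]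
  have h5 : ∀ g ∈ Sᶜ, ∑ x : ℙ K (Fin 2 → K), ((if g • x = x then (1 : ℤ) else 0) +
        if g • x.rep = x.rep ∨ g • x.rep = -x.rep then 1 else 0) = 2 := by
    intro g hg
    simp only [S, Finset.mem_compl, Finset.mem_insert, Finset.mem_singleton, not_or] at hg
    obtain ⟨a, ha⟩ := hev g g.2
    have := sl2_card_fixed_add_card (g := (g : SL(2, K))) (fun h => hg.1 (Subtype.ext h))
      (fun h => hg.2 (Subtype.ext h)) ha
    rw [Finset.sum_add_distrib, Finset.sum_boole, Finset.sum_boole, ← Fintype.card_subtype,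
      ← Fintype.card_subtype, ← Nat.card_eq_fintype_card, ← Nat.card_eq_fintype_card]
    exact_mod_cast this
  rw [Finset.sum_congr rfl h5, Finset.sum_const, Finset.card_compl, hS, nsmul_eq_mul,
    Nat.card_eq_fintype_card, Nat.cast_sub]
  · push_cast; ring
  · have := Finset.card_le_univ S
    omega

end Stabilizers

section Unipotent

variable {F : Type*} [Field F]

/-- The upper unipotent matrix with off-diagonal entry `b`. -/
def upperUnipotent (b : F) : SL(2, F) :=
  ⟨!![1, b; 0, 1], by simp [Matrix.det_fin_two]⟩

theorem upperUnipotent_apply (b : F) : upperUnipotent b 0 0 = 1 ∧ upperUnipotent b 0 1 = b ∧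
    upperUnipotent b 1 0 = 0 ∧ upperUnipotent b 1 1 = 1 := by
  simp [upperUnipotent]

theorem sl2_mul_apply (g h : SL(2, F)) (i j : Fin 2) :
    (g * h) i j = g i 0 * h 0 j + g i 1 * h 1 j := by
  simp [Matrix.mul_apply, Fin.sum_univ_two]

theorem sl2_ext {g h : SL(2, F)} (h00 : g 0 0 = h 0 0) (h01 : g 0 1 = h 0 1)
    (h10 : g 1 0 = h 1 0) (h11 : g 1 1 = h 1 1) : g = h := by
  ext i j
  fin_cases i <;> fin_cases j <;> assumption

theorem sl2_smul_single_eq_iff (g : SL(2, F)) :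
    g • (![1, 0] : Fin 2 → F) = ![1, 0] ↔ g = upperUnipotent (g 0 1) := by
  rw [sl2_smul_eq_iff]
  constructor
  · rintro ⟨h0, h1⟩
    simp only [Matrix.cons_val_zero, Matrix.cons_val_one, mul_one, mul_zero, add_zero] at h0 h1
    have hd := sl2_det g
    rw [h0, h1] at hd
    have h11 : g 1 1 = 1 := by linear_combination hd
    ext i j
    fin_cases i <;> fin_cases j <;> simp [upperUnipotent, h0, h1, h11]
  · intro h
    rw [h]
    simp [upperUnipotent]

theorem card_stabilizer_sl2 {w : Fin 2 → F} (hw : w ≠ 0) :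
    Nat.card (stabilizer SL(2, F) w) = Nat.card F := by
  obtain ⟨s, rfl⟩ := sl2_exists_smul_single hw
  rw [← Nat.card_congr
    (stabilizerEquivStabilizer (g := s) (a := (![1, 0] : Fin 2 → F)) rfl).toEquiv]
  refine Nat.card_congr ⟨fun g => (g : SL(2, F)) 0 1, fun b => ⟨upperUnipotent b, ?_⟩, ?_, ?_⟩
  · rw [mem_stabilizer_iff, sl2_smul_single_eq_iff, (upperUnipotent_apply b).2.1]
  · rintro ⟨g, hg⟩
    rw [mem_stabilizer_iff, sl2_smul_single_eq_iff] at hg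
    exact Subtype.ext hg.symm
  · intro b
    simp [upperUnipotent]

theorem sl2_subgroup_eq_top {H : Subgroup SL(2, F)} (hU : ∀ b, upperUnipotent b ∈ H)
    {g : SL(2, F)} (hg : g ∈ H) (hg0 : g 1 0 ≠ 0) : H = ⊤ := by
  have key : ∀ g ∈ H, ∀ h : SL(2, F), g 1 0 ≠ 0 → h 1 0 = g 1 0 → h ∈ H := by
    intro g hg h hg0 hh
    have : h = upperUnipotent ((h 0 0 - g 0 0) / g 1 0) * g *
        upperUnipotent ((h 1 1 - g 1 1) / g 1 0) := by
      have d1 := sl2_det g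
      have d2 := sl2_det h
      rw [hh] at d2
      apply sl2_ext <;> simp only [sl2_mul_apply, upperUnipotent_apply] <;> field_simp
      · ring
      · linear_combination -d2 + d1
      · linear_combination hh
      · ring
    rw [this]
    exact H.mul_mem (H.mul_mem (hU _) hg) (hU _)
  have key2 : ∀ h : SL(2, F), h 1 0 ≠ 0 → h ∈ H := by
    intro h hh
    let k : SL(2, F) := g * upperUnipotent ((h 1 0 / g 1 0 - g 0 0 - g 1 1) / g 1 0) * g
    have hk : k ∈ H := H.mul_mem (H.mul_mem hg (hU _)) hg
    have hk0 : k 1 0 = h 1 0 := by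
      simp only [k, sl2_mul_apply, upperUnipotent_apply]
      field_simp
      ring
    exact key k hk h (hk0 ▸ hh) hk0.symm
  rw [Subgroup.eq_top_iff']
  intro h
  by_cases hh : h 1 0 = 0
  · have : (h * g) 1 0 ≠ 0 := by
      have d := sl2_det h
      rw [sl2_mul_apply, hh, zero_mul, zero_add]
      refine mul_ne_zero (fun h1 => ?_) hg0
      simp [hh, h1] at d
    have := H.mul_mem (key2 _ this) (H.inv_mem hg)
    simpa using this
  · exact key2 h hh

theorem sl2_subgroup_eq_top_of_stabilizer_le {H : Subgroup SL(2, F)} {w : Fin 2 → F} (hw : w ≠ 0)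
    (hU : stabilizer SL(2, F) w ≤ H) {g : SL(2, F)} (hg : g ∈ H) (hgw : ∀ a : F, g • w ≠ a • w) :
    H = ⊤ := by
  obtain ⟨s, rfl⟩ := sl2_exists_smul_single hw
  have : H.comap (MulAut.conj s).toMonoidHom = ⊤ := by
    apply sl2_subgroup_eq_top (g := s⁻¹ * g * s)
    · intro b
      apply hU
      have : upperUnipotent b • (![1, 0] : Fin 2 → F) = ![1, 0] := by
        rw [sl2_smul_single_eq_iff, (upperUnipotent_apply b).2.1]
      simp [mem_stabilizer_iff, mul_smul, this]
    · rw [Subgroup.mem_comap]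
      simpa [mul_assoc] using hg
    · intro h
      have : (s⁻¹ * g * s) • (![1, 0] : Fin 2 → F) = (s⁻¹ * g * s) 0 0 • ![1, 0] := by
        rw [sl2_smul_smul_eq_iff]
        simp only [h]
        simp
      have h1 := congrArg (s • ·) this
      rw [smul_comm s ((s⁻¹ * g * s) 0 0), ← mul_smul, ← mul_assoc, ← mul_assoc, mul_inv_cancel,
        one_mul, mul_smul] at h1
      exact hgw _ h1
  rw [Subgroup.eq_top_iff'] at this ⊢
  intro h
  have := this (s⁻¹ * h * s)
  simpa [Subgroup.mem_comap, mul_assoc] using this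

end Unipotent

section Rational

variable {F K : Type*} [Field F] [Field K] [Algebra F K]

/-- Extension of scalars. -/
abbrev sl2Map (F K : Type*) [Field F] [Field K] [Algebra F K] : SL(2, F) →* SL(2, K) :=
  Matrix.SpecialLinearGroup.map (algebraMap F K)

theorem sl2Map_apply (g : SL(2, F)) (i j : Fin 2) :
    sl2Map F K g i j = algebraMap F K (g i j) := rfl

theorem sl2Map_injective : Function.Injective (sl2Map F K) := by
  intro g h hgh
  ext i j
  apply FaithfulSMul.algebraMap_injective F K
  rw [← sl2Map_apply, hgh, sl2Map_apply]

theorem sl2Map_smul_smul_iff (g : SL(2, F)) (w : Fin 2 → F) (a : F) :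
    sl2Map F K g • (algebraMap F K ∘ w) = algebraMap F K a • (algebraMap F K ∘ w) ↔
      g • w = a • w := by
  rw [sl2_smul_smul_eq_iff, sl2_smul_smul_eq_iff]
  simp only [sl2Map_apply, Function.comp, ← map_mul, ← map_add,
    (FaithfulSMul.algebraMap_injective F K).eq_iff]

theorem sl2Map_smul_iff (g : SL(2, F)) (w : Fin 2 → F) :
    sl2Map F K g • (algebraMap F K ∘ w) = (algebraMap F K ∘ w) ↔ g • w = w := by
  have := sl2Map_smul_smul_iff (K := K) g w 1
  simpa using this

theorem exists_rational_of_sl2Map_smul (h2 : (2 : K) ≠ 0) {g : SL(2, F)} (hg : g ≠ 1)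
    {v : Fin 2 → K} (hv : v ≠ 0)
    (hgv : sl2Map F K g • v = v) :
    ∃ w : Fin 2 → F, w ≠ 0 ∧ ∃ c : Kˣ, v = c • (algebraMap F K ∘ w) := by
  have h := sl2_eigenvalue_eq hv (a := 1) (by rw [hgv, one_smul])
  have h' : (1 : F) * 1 - (g 0 0 + g 1 1) * 1 + 1 = 0 := by
    apply FaithfulSMul.algebraMap_injective F K
    simpa [sl2Map_apply] using h
  obtain ⟨w, hw, hgw⟩ := sl2_exists_eigenvector h'
  rw [one_smul, ← sl2Map_smul_iff (K := K)] at hgw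
  have hw' : (algebraMap F K ∘ w) ≠ 0 := by
    intro h
    apply hw
    ext i
    have := congrFun h i
    simpa using this
  refine ⟨w, hw, ?_⟩
  by_cases hd : v 0 * (algebraMap F K ∘ w) 1 - v 1 * (algebraMap F K ∘ w) 0 = 0
  · rw [← projectivization_mk_eq_iff hv hw', Projectivization.mk_eq_mk_iff] at hd
    obtain ⟨c, hc⟩ := hd
    exact ⟨c, hc.symm⟩
  · exfalso
    rcases sl2_eq_scalar_of_smul (a := 1) (by rw [hgv, one_smul])
      (by rw [hgw, one_smul]) hd with h1 | h1
    · exact hg (sl2Map_injective (h1.trans (map_one _).symm))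
    · rw [h1, sl2_smul_neg, one_smul, neg_eq_iff_add_eq_zero, ← two_smul K, smul_eq_zero] at hgv
      exact hgv.elim h2 hv

end Rational

section Generation

variable {F K : Type*} [Field F] [Field K] [Algebra F K]

theorem card_orbit_mul_card_stabilizer {G X : Type*} [Group G] [MulAction G X] (x : X) :
    Nat.card (orbit G x) * Nat.card (stabilizer G x) = Nat.card G := by
  rw [← (stabilizer G x).index_mul_card, index_stabilizer, Nat.card_coe_set_eq]

theorem card_stabilizer_rep_dvd [Finite F] (h2 : (2 : K) ≠ 0) {H : Subgroup SL(2, F)}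
    {x : ℙ K (Fin 2 → K)}
    (hx : Nat.card (stabilizer (H.map (sl2Map F K)) x.rep) ≠ 1)
    (horb : Nat.card (orbit (H.map (sl2Map F K)) x) ≠ 1) :
    Nat.card (stabilizer (H.map (sl2Map F K)) x.rep) ∣ Nat.card F ∧
      (Nat.card (stabilizer (H.map (sl2Map F K)) x.rep) = Nat.card F → H = ⊤) := by
  obtain ⟨⟨⟨u, g, hgH, rfl⟩, hu⟩, hu1⟩ :
      ∃ u : stabilizer (H.map (sl2Map F K)) x.rep, u ≠ 1 := by
    by_contra! hc
    exact hx (Nat.card_eq_one_iff_exists.2 ⟨1, fun y => hc y⟩)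
  have hg1 : g ≠ 1 := by
    rintro rfl
    apply hu1
    ext : 2
    exact map_one _
  obtain ⟨w, hw, c, hc⟩ := exists_rational_of_sl2Map_smul h2 hg1 x.rep_nonzero hu
  have hiff : ∀ g : SL(2, F), sl2Map F K g • x.rep = x.rep ↔ g • w = w := by
    intro g
    rw [hc, smul_comm, smul_left_cancel_iff, sl2Map_smul_iff]
  have hcard : Nat.card (stabilizer (H.map (sl2Map F K)) x.rep) =
      Nat.card ((H ⊓ stabilizer SL(2, F) w : Subgroup SL(2, F)) : Subgroup SL(2, F)) := by
    symm
    refine Nat.card_congr (Equiv.ofBijective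
      (fun g => ⟨⟨sl2Map F K g, Subgroup.mem_map_of_mem _ g.2.1⟩, (hiff g).2 g.2.2⟩) ⟨?_, ?_⟩)
    · intro g g' h
      have h' : sl2Map F K g = sl2Map F K g' := by
        exact congrArg Subtype.val (congrArg Subtype.val h)
      exact Subtype.ext (sl2Map_injective h')
    · rintro ⟨⟨_, g, hg, rfl⟩, h⟩
      exact ⟨⟨g, hg, (hiff g).1 h⟩, rfl⟩
  rw [hcard, ← card_stabilizer_sl2 hw]
  refine ⟨Subgroup.card_dvd_of_le inf_le_right, fun h => ?_⟩
  have hle : stabilizer SL(2, F) w ≤ H := by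
    have := Subgroup.eq_of_le_of_card_ge (inf_le_right : H ⊓ stabilizer SL(2, F) w ≤ _) h.ge
    exact inf_eq_right.1 this
  obtain ⟨g, hgH, hgx⟩ : ∃ g ∈ H, sl2Map F K g • x ≠ x := by
    by_contra! hcon
    apply horb
    rw [Nat.card_eq_one_iff_exists]
    refine ⟨⟨x, mem_orbit_self x⟩, ?_⟩
    rintro ⟨_, ⟨_, g, hg, rfl⟩, rfl⟩
    exact Subtype.ext (hcon g hg)
  refine sl2_subgroup_eq_top_of_stabilizer_le hw hle hgH fun a ha => hgx ?_
  rw [← x.mk_rep, sl2_smul_mk_eq_iff]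
  refine ⟨algebraMap F K a, ?_⟩
  rw [hc, smul_comm, (sl2Map_smul_smul_iff g w a).2 ha, smul_comm]

theorem card_sl2Map_map (H : Subgroup SL(2, F)) :
    Nat.card (H.map (sl2Map F K)) = Nat.card H :=
  Nat.card_congr (H.equivMapOfInjective _ sl2Map_injective).symm.toEquiv

theorem exists_root_of_isSquare (h2 : (2 : K) ≠ 0) (hsq : ∀ a : F, IsSquare (algebraMap F K a))
    (t : F) : ∃ a : K, a * a - algebraMap F K t * a + 1 = 0 := by
  obtain ⟨d, hd⟩ := hsq (t * t - 4)
  refine ⟨(algebraMap F K t + d) / 2, ?_⟩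
  simp only [map_sub, map_mul, map_ofNat] at hd
  field_simp
  linear_combination -hd

/-- A subgroup of `SL₂(F)` containing `-1` and an element of order `q ± 1 ≥ 8`, and having no small
orbit on the projective line over the quadratic extension, is the whole group, up to two
exceptional orders. -/
theorem sl2_subgroup_eq_top_or [Finite F] [Finite K] (h2 : (2 : F) ≠ 0)
    (hsq : ∀ a : F, IsSquare (algebraMap F K a)) {H : Subgroup SL(2, F)} (hneg : -1 ∈ H)
    (horb : ∀ x : ℙ K (Fin 2 → K), 3 ≤ Nat.card (orbit (H.map (sl2Map F K)) x))
    {c : SL(2, F)} (hc : c ∈ H) {r : ℕ} (hcr : orderOf c = 2 * r) (hr : 4 ≤ r)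
    (hrq : 2 * r = Nat.card F + 1 ∨ 2 * r + 1 = Nat.card F) :
    H = ⊤ ∨ (r = 4 ∧ Nat.card H = 48) ∨ (r = 5 ∧ Nat.card H = 120) := by
  classical
  by_cases htop : H = ⊤
  · exact Or.inl htop
  right
  have h2K : (2 : K) ≠ 0 := by
    intro h
    apply h2
    apply FaithfulSMul.algebraMap_injective F K
    rw [map_ofNat, map_zero, h]
  set q := Nat.card F with hq
  set L := H.map (sl2Map F K) with hL
  have hnegL : -1 ∈ L := ⟨-1, hneg, by apply sl2_ext <;> simp [sl2Map_apply]⟩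
  have hfin : Finite (ℙ K (Fin 2 → K)) := inferInstance
  have := Fintype.ofFinite (ℙ K (Fin 2 → K))
  have hev : ∀ g ∈ L, ∃ a : K, a * a - (g 0 0 + g 1 1) * a + 1 = 0 := by
    rintro _ ⟨g, -, rfl⟩
    simp only [sl2Map_apply, ← map_add]
    exact exists_root_of_isSquare h2K hsq _
  let m : ℙ K (Fin 2 → K) → ℕ := fun x => Nat.card (stabilizer L x.rep)
  let n : ℙ K (Fin 2 → K) → ℕ := fun x => Nat.card (stabilizer L x)
  have hm0 : ∀ x, 0 < m x := fun x => Nat.card_pos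
  have hn0 : ∀ x, 0 < n x := fun x => Nat.card_pos
  have hsign : ∀ x : ℙ K (Fin 2 → K), Nat.card (signStabilizer L x.rep) = 2 * m x := fun x =>
    card_signStabilizer h2K hnegL x.rep_nonzero
  have hdvd : ∀ x, 2 * m x ∣ n x := fun x => hsign x ▸
    Subgroup.card_dvd_of_le (signStabilizer_le_stabilizer x)
  choose k hk using hdvd
  have hk0 : ∀ x, 0 < k x := by
    intro x
    rw [Nat.pos_iff_ne_zero]
    intro h
    have := hn0 x
    rw [hk, h] at this
    simp at this
  have horbn : ∀ x, Nat.card (orbit L x) * n x = Nat.card L := fun x =>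
    card_orbit_mul_card_stabilizer x
  obtain ⟨v, hv, hcv⟩ : ∃ v : Fin 2 → K, v ≠ 0 ∧ ∃ a : K, sl2Map F K c • v = a • v := by
    obtain ⟨a, ha⟩ := hev _ (Subgroup.mem_map_of_mem _ hc)
    obtain ⟨v, hv, hva⟩ := sl2_exists_eigenvector ha
    exact ⟨v, hv, a, hva⟩
  rw [← sl2_smul_mk_eq_iff _ hv] at hcv
  set P := Projectivization.mk K v hv with hP
  obtain ⟨h, hh⟩ : ∃ h, Nat.card L = 2 * h := by
    refine ⟨Nat.card (orbit L P) * (m P * k P), ?_⟩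
    rw [← horbn P, hk]
    ring
  have hcard : ∀ x, Nat.card (orbit L x) * (m x * k x) = h := by
    intro x
    have := horbn x
    rw [hk, hh] at this
    apply Nat.eq_of_mul_eq_mul_left (two_pos)
    rw [← this]
    ring
  have hhpos : 0 < h := by
    have : 0 < Nat.card L := Nat.card_pos
    omega
  have hrP : 2 * r ∣ n P := by
    have : orderOf (⟨⟨sl2Map F K c, Subgroup.mem_map_of_mem _ hc⟩, hcv⟩ : stabilizer L P) =
        2 * r := by
      rw [← hcr, ← Subgroup.orderOf_coe, ← Subgroup.orderOf_coe]
      exact orderOf_injective _ sl2Map_injective c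
    rw [← this]
    exact orderOf_dvd_natCard _
  rw [hk, mul_assoc] at hrP
  replace hrP := Nat.dvd_of_mul_dvd_mul_left two_pos hrP
  have hqodd : Odd q := by
    rw [Nat.odd_iff]
    omega
  have hm : ∀ x, m x = 1 ∨ (3 ≤ m x ∧ Odd (m x) ∧ k x + 1 ≤ m x ∧ 3 * m x ≤ q) := by
    intro x
    by_cases hx : m x = 1
    · exact Or.inl hx
    right
    obtain ⟨h1, h3⟩ := card_stabilizer_rep_dvd h2K hx
      (fun h => by have := horb x; rw [h] at this; omega)
    have hne : m x ≠ q := fun h => htop (h3 h)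
    have hle := card_stabilizer_le_mul hx
    rw [hsign] at hle
    change n x ≤ 2 * m x * (m x - 1) at hle
    rw [hk] at hle
    have hle' : k x ≤ m x - 1 := Nat.le_of_mul_le_mul_left hle (by have := hm0 x; omega)
    obtain ⟨j, hj⟩ := h1
    change q = m x * j at hj
    rw [hj, Nat.odd_mul] at hqodd
    have hmx := hm0 x
    have hodd := hqodd.1
    have hj3 : 3 ≤ j := by
      obtain ⟨i, rfl⟩ := hqodd.2
      by_contra hlt
      have : i = 0 := by omega
      subst this
      apply hne
      rw [hj]
      ring
    refine ⟨?_, hodd, by omega, ?_⟩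
    · rw [Nat.odd_iff] at hodd
      omega
    · rw [hj, mul_comm]
      exact Nat.mul_le_mul_left _ hj3
  have hmP : m P = 1 := by
    rcases hm P with h1 | ⟨h3, -, hlt, hle⟩
    · exact h1
    exfalso
    have hcop : Nat.Coprime r (m P) := by
      have hd : m P ∣ q := (card_stabilizer_rep_dvd h2K (by change m P ≠ 1; omega)
        (fun h => by have := horb P; rw [h] at this; omega)).1
      have : Nat.Coprime (2 * r) q := by
        rcases hrq with h | h
        · rw [h]; simp
        · rw [← h]; simp
      exact (this.coprime_mul_left).coprime_dvd_right hd
    have := Nat.le_of_dvd (hk0 P) (hcop.dvd_of_dvd_mul_left hrP)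
    omega
  rw [hmP, one_mul] at hrP
  have hrk := Nat.le_of_dvd (hk0 P) hrP
  have hsum : ∑ x, ((m x * k x + m x : ℤ) - 2) = 2 * h - 2 := by
    have h3 := sum_card_stabilizers h2K hnegL hev
    have h4 : ∀ x : ℙ K (Fin 2 → K), ((Nat.card (stabilizer L x) +
        Nat.card (signStabilizer L x.rep) : ℤ) - 4) = 2 * ((m x * k x + m x : ℤ) - 2) := by
      intro x
      rw [hsign]
      change ((n x : ℤ) + _ - 4) = _
      rw [hk]
      push_cast
      ring
    rw [Finset.sum_congr rfl fun x _ => h4 x, ← Finset.mul_sum, hh] at h3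
    push_cast at h3
    linarith
  have hcardH : Nat.card H = 2 * h := by
    rw [← hh, hL, card_sl2Map_map]
  rcases card_eq_of_sum_orbits hhpos (fun g x => card_stabilizer_smul_rep g x) hcard horb hsum hm
    hmP (hr.trans hrk) (by omega) with ⟨h1, h3⟩ | ⟨h1, h3⟩
  · left
    rw [h1] at hrk
    omega
  · right
    rw [h1] at hrP hrk
    have : r ≠ 4 := by
      rintro rfl
      omega
    omega

end Generation

section Orbits

variable {K : Type*} [Field K]

theorem three_le_card_orbit_of_smul_ne [Finite K] {L : Subgroup SL(2, K)} {g : SL(2, K)}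
    (hg : g ∈ L) (hev : ∃ a : K, a * a - (g 0 0 + g 1 1) * a + 1 = 0) (h1 : g ^ 2 ≠ 1)
    (h2 : g ^ 2 ≠ -1) {x : ℙ K (Fin 2 → K)} (hx : g • x ≠ x) :
    3 ≤ Nat.card (orbit L x) := by
  classical
  obtain ⟨a, ha⟩ := hev
  obtain ⟨v, hv, hgv⟩ := sl2_exists_eigenvector ha
  set y := Projectivization.mk K v hv with hy
  have hgy : g • y = y := (sl2_smul_mk_eq_iff g hv).2 ⟨a, hgv⟩
  have hyx : y ≠ x := by
    rintro h
    rw [h] at hgy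
    exact hx hgy
  have hygx : y ≠ g • x := by
    intro h
    rw [h, smul_left_cancel_iff] at hgy
    exact hx hgy
  have hggx : g ^ 2 • x ≠ x := by
    intro h
    have hg2 : g ^ 2 • v = (a * a) • v := by
      rw [pow_two, mul_smul, hgv, smul_comm, hgv, smul_smul]
    have hle := sl2_card_fixed_add_card h1 h2 (sl2_eigenvalue_eq hv hg2)
    have h3 : 3 ≤ Nat.card {z : ℙ K (Fin 2 → K) // g ^ 2 • z = z} := by
      have hsub : ((({y, x, g • x} : Finset (ℙ K (Fin 2 → K)))) : Set (ℙ K (Fin 2 → K))) ⊆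
          {z | g ^ 2 • z = z} := by
        intro z hz
        simp only [Finset.coe_insert, Finset.coe_singleton, Set.mem_insert_iff,
          Set.mem_singleton_iff] at hz
        rcases hz with rfl | rfl | rfl
        · change g ^ 2 • y = y
          rw [pow_two, mul_smul, hgy, hgy]
        · exact h
        · change g ^ 2 • g • x = g • x
          rw [← mul_smul, ← pow_succ, pow_succ', mul_smul, h]
      have := Set.ncard_le_ncard hsub (Set.toFinite _)
      rw [Set.ncard_coe_finset, Finset.card_eq_three.2 ⟨y, x, g • x, hyx, hygx, hx.symm, rfl⟩]
        at this
      exact this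
    omega
  have hsub : ((({x, g • x, g ^ 2 • x} : Finset (ℙ K (Fin 2 → K)))) : Set (ℙ K (Fin 2 → K))) ⊆
      orbit L x := by
    intro z hz
    simp only [Finset.coe_insert, Finset.coe_singleton, Set.mem_insert_iff,
      Set.mem_singleton_iff] at hz
    rcases hz with rfl | rfl | rfl
    · exact mem_orbit_self _
    · exact ⟨⟨g, hg⟩, rfl⟩
    · exact ⟨⟨g ^ 2, L.pow_mem hg 2⟩, rfl⟩
  have := Set.ncard_le_ncard hsub (Set.toFinite _)
  rwa [Set.ncard_coe_finset, Finset.card_eq_three.2 ⟨x, g • x, g ^ 2 • x, hx.symm, hggx.symm, ?_,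
    rfl⟩,
    ← Nat.card_coe_set_eq] at this
  rw [pow_two, mul_smul]
  exact fun h => hx ((smul_left_cancel_iff g).1 h).symm

theorem sl2_trace_relation_of_common_fixed_point {A B : SL(2, K)} {x : ℙ K (Fin 2 → K)}
    (hA : A • x = x) (hB : B • x = x) {α β γ : K} (hα : A 0 0 + A 1 1 = α)
    (hβ : B 0 0 + B 1 1 = β) (hγ : (A * B) 0 0 + (A * B) 1 1 = γ) :
    α ^ 2 + β ^ 2 + γ ^ 2 - α * β * γ - 4 = 0 := by
  rw [← x.mk_rep, sl2_smul_mk_eq_iff] at hA hB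
  obtain ⟨a, ha⟩ := hA
  obtain ⟨b, hb⟩ := hB
  have hab : (A * B) • x.rep = (a * b) • x.rep := by
    rw [mul_smul, hb, smul_comm, ha, smul_smul, mul_comm]
  have h1 := sl2_eigenvalue_eq x.rep_nonzero ha
  have h2 := sl2_eigenvalue_eq x.rep_nonzero hb
  have h3 := sl2_eigenvalue_eq x.rep_nonzero hab
  rw [hα] at h1
  rw [hβ] at h2
  rw [hγ] at h3
  have ha0 : a ≠ 0 := by
    rintro rfl
    simp at h1
  have hb0 : b ≠ 0 := by
    rintro rfl
    simp at h2
  have e1 : α = a + a⁻¹ := by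
    field_simp
    linear_combination -h1
  have e2 : β = b + b⁻¹ := by
    field_simp
    linear_combination -h2
  have e3 : γ = a * b + (a * b)⁻¹ := by
    field_simp
    linear_combination -h3
  rw [e1, e2, e3]
  field_simp
  ring

end Orbits

section Center

variable {F : Type*} [Field F]

theorem sl2_mem_center_iff (g : SL(2, F)) :
    g ∈ Subgroup.center SL(2, F) ↔ g = 1 ∨ g = -1 := by
  constructor
  · intro h
    rw [Matrix.SpecialLinearGroup.mem_center_iff] at h
    obtain ⟨r, hr, hg⟩ := h
    have h00 := congrFun (congrFun hg 0) 0
    have h01 := congrFun (congrFun hg 0) 1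
    have h10 := congrFun (congrFun hg 1) 0
    have h11 := congrFun (congrFun hg 1) 1
    simp at h00 h01 h10 h11
    rw [Fintype.card_fin, pow_two, mul_self_eq_one_iff] at hr
    rcases hr with rfl | rfl
    · left
      apply sl2_ext <;> simp [← h00, ← h01, ← h10, ← h11]
    · right
      apply sl2_ext <;> simp [← h00, ← h01, ← h10, ← h11]
  · rintro (rfl | rfl)
    · exact one_mem _
    · rw [Subgroup.mem_center_iff]
      intro g
      simp

/-- The projection onto the projective special linear group. -/
abbrev pslMk (F : Type*) [Field F] : SL(2, F) →* PSL2 F :=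
  QuotientGroup.mk' (Subgroup.center SL(2, F))

theorem pslMk_surjective : Function.Surjective (pslMk F) := QuotientGroup.mk'_surjective _

theorem pslMk_eq_one_iff (g : SL(2, F)) : pslMk F g = 1 ↔ g = 1 ∨ g = -1 := by
  rw [← sl2_mem_center_iff]
  exact QuotientGroup.eq_one_iff g

theorem pslMk_neg (g : SL(2, F)) : pslMk F (-g) = pslMk F g := by
  have : pslMk F (-1) = 1 := (pslMk_eq_one_iff _).2 (Or.inr rfl)
  rw [← neg_one_mul, map_mul, this, one_mul]

theorem sl2_one_ne_neg_one (h2 : (2 : F) ≠ 0) : (1 : SL(2, F)) ≠ -1 := by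
  intro h
  have := congrArg (fun M : SL(2, F) => M 0 0) h
  simp at this
  apply h2
  linear_combination this

theorem sl2_sq_eq_one (h2 : (2 : F) ≠ 0) {g : SL(2, F)} (h : g ^ 2 = 1) : g = 1 ∨ g = -1 := by
  have hd := sl2_det g
  have hg : g = g⁻¹ := by
    rw [eq_inv_iff_mul_eq_one, ← pow_two, h]
  rw [Matrix.SpecialLinearGroup.SL2_inv_expl] at hg
  have h00 := congrArg (fun M : SL(2, F) => M 0 0) hg
  have h01 := congrArg (fun M : SL(2, F) => M 0 1) hg
  have h10 := congrArg (fun M : SL(2, F) => M 1 0) hg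
  simp at h00 h01 h10
  have e01 : g 0 1 = 0 := by
    apply mul_left_cancel₀ h2
    linear_combination h01
  have e10 : g 1 0 = 0 := by
    apply mul_left_cancel₀ h2
    linear_combination h10
  rw [← h00, e01] at hd
  have hd' : g 0 0 * g 0 0 = 1 := by linear_combination hd
  rcases mul_self_eq_one_iff.1 hd' with h0 | h0
  · left
    apply sl2_ext <;> simp [e01, e10, h0, ← h00]
  · right
    apply sl2_ext <;> simp [e01, e10, h0, ← h00]

theorem exists_orderOf_eq_two_mul (h2 : (2 : F) ≠ 0) {g : SL(2, F)} {r : ℕ}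
    (hr : orderOf (pslMk F g) = r) (hr2 : 2 ≤ r) :
    ∃ c : SL(2, F), (c = g ∨ c = -g) ∧ orderOf c = 2 * r := by
  have key : ∀ c : SL(2, F), orderOf (pslMk F c) = r → c ^ r = -1 → orderOf c = 2 * r := by
    intro c hc hcr
    obtain ⟨j, hj⟩ := hc ▸ orderOf_map_dvd (pslMk F) c
    have h1 : orderOf c ∣ r * 2 := by
      rw [orderOf_dvd_iff_pow_eq_one, pow_mul, hcr]
      simp
    rw [hj] at h1
    have h3 := (Nat.dvd_prime Nat.prime_two).1 (Nat.dvd_of_mul_dvd_mul_left (by omega) h1)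
    rcases h3 with rfl | rfl
    · exfalso
      apply sl2_one_ne_neg_one h2
      rw [← hcr, ← pow_orderOf_eq_one c, hj, mul_one]
    · rw [hj, mul_comm]
  have hgr : g ^ r = 1 ∨ g ^ r = -1 := by
    rw [← pslMk_eq_one_iff, map_pow, ← hr, pow_orderOf_eq_one]
  rcases hgr with h | h
  · rcases Nat.even_or_odd r with ⟨s, hs⟩ | hodd
    · exfalso
      rw [hs, ← two_mul, mul_comm, pow_mul] at h
      have := sl2_sq_eq_one h2 h
      rw [← pslMk_eq_one_iff, map_pow] at this
      have := Nat.le_of_dvd (by omega) (orderOf_dvd_of_pow_eq_one this)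
      omega
    · exact ⟨-g, Or.inr rfl, key _ (by rw [pslMk_neg, hr]) (by rw [hodd.neg_pow, h])⟩
  · exact ⟨g, Or.inl rfl, key g hr h⟩

theorem sl2_pow_smul {g : SL(2, F)} {v : Fin 2 → F} {a : F} (h : g • v = a • v) (n : ℕ) :
    g ^ n • v = a ^ n • v := by
  induction n with
  | zero => simp
  | succ n ih => rw [pow_succ, mul_smul, h, smul_comm, ih, smul_smul, pow_succ']

theorem sl2_pow_eq_iff {g : SL(2, F)} {a : F} (ha : a * a - (g 0 0 + g 1 1) * a + 1 = 0)
    (ha2 : a ^ 2 ≠ 1) (n : ℕ) : (g ^ n = 1 ∨ g ^ n = -1) ↔ (a ^ 2) ^ n = 1 := by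
  obtain ⟨v, hv, hgv⟩ := sl2_exists_eigenvector ha
  have ha0 : a ≠ 0 := by
    rintro rfl
    simp at ha
  have hb : a⁻¹ * a⁻¹ - (g 0 0 + g 1 1) * a⁻¹ + 1 = 0 := by
    field_simp
    linear_combination ha
  obtain ⟨w, hw, hgw⟩ := sl2_exists_eigenvector hb
  have hn := sl2_pow_smul hgv n
  constructor
  · rintro (h | h)
    · rw [h, one_smul] at hn
      have : (a ^ n - 1) • v = 0 := by rw [sub_smul, ← hn, one_smul, sub_self]
      rw [smul_eq_zero, or_iff_left hv, sub_eq_zero] at this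
      rw [pow_right_comm, this, one_pow]
    · rw [h, sl2_smul_neg, one_smul] at hn
      have : (a ^ n + 1) • v = 0 := by rw [add_smul, ← hn, one_smul, neg_add_cancel]
      rw [smul_eq_zero, or_iff_left hv] at this
      rw [pow_right_comm, eq_neg_of_add_eq_zero_left this]
      simp
  · intro h
    have hvw : v 0 * w 1 - v 1 * w 0 ≠ 0 := by
      intro h0
      rw [← projectivization_mk_eq_iff hv hw, Projectivization.mk_eq_mk_iff'] at h0
      obtain ⟨c, rfl⟩ := h0
      rw [smul_comm, hgw, smul_comm, ← sub_eq_zero, ← sub_smul, smul_eq_zero, or_iff_left hv,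
        sub_eq_zero] at hgv
      apply ha2
      field_simp at hgv
      exact hgv.symm
    have hm := sl2_pow_smul hgw n
    rw [pow_right_comm, pow_two, mul_self_eq_one_iff] at h
    have : (a⁻¹) ^ n = a ^ n := by
      rcases h with h | h <;> simp [h]
    rw [this] at hm
    exact sl2_eq_scalar_of_smul hn hm hvw

end Center

section Orders

variable {F : Type*} [Field F]

theorem orderOf_pslMk_eq {K : Type*} [Field K] [Algebra F K] {g : SL(2, F)} {a : K}
    (ha : a * a - algebraMap F K (g 0 0 + g 1 1) * a + 1 = 0) (ha2 : a ^ 2 ≠ 1) :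
    orderOf (pslMk F g) = orderOf (a ^ 2) := by
  rw [orderOf_eq_orderOf_iff]
  intro n
  rw [← map_pow, pslMk_eq_one_iff, ← sl2_pow_eq_iff (g := sl2Map F K g)
    (by simpa only [sl2Map_apply, ← map_add] using ha) ha2 n, ← map_pow]
  have hneg : sl2Map F K (-1) = -1 := by apply sl2_ext <;> simp [sl2Map_apply]
  rw [← (sl2Map_injective (K := K)).eq_iff (a := g ^ n) (b := 1), map_one,
    ← (sl2Map_injective (K := K)).eq_iff (a := g ^ n) (b := -1), hneg]

theorem exists_root_algebraicClosure (h2 : (2 : F) ≠ 0) (t : F) :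
    ∃ a : AlgebraicClosure F, a * a - algebraMap F (AlgebraicClosure F) t * a + 1 = 0 := by
  refine exists_root_of_isSquare ?_ (fun a => ?_) t
  · intro h
    apply h2
    apply FaithfulSMul.algebraMap_injective F (AlgebraicClosure F)
    rw [map_ofNat, map_zero, h]
  · obtain ⟨z, hz⟩ := IsAlgClosed.exists_pow_nat_eq (algebraMap F (AlgebraicClosure F) a) two_pos
    exact ⟨z, by rw [← hz, pow_two]⟩

theorem sq_ne_one_of_trace {K : Type*} [Field K] {a t : K} (h : a * a - t * a + 1 = 0)
    (ht : t ^ 2 ≠ 4) : a ^ 2 ≠ 1 := by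
  intro h1
  rw [pow_two, mul_self_eq_one_iff] at h1
  apply ht
  rcases h1 with rfl | rfl
  · have : t = 2 := by linear_combination -h
    rw [this]; norm_num
  · have : t = -2 := by linear_combination h
    rw [this]; norm_num

theorem orderOf_pslMk_eq_five (h2 : (2 : F) ≠ 0) (h5 : (5 : F) ≠ 0) {g : SL(2, F)} {u : F}
    (hu : g 0 0 + g 1 1 = u) (h : u ^ 2 + u - 1 = 0 ∨ u ^ 2 - u - 1 = 0) :
    orderOf (pslMk F g) = 5 := by
  obtain ⟨a, ha⟩ := exists_root_algebraicClosure h2 u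
  have hinj := FaithfulSMul.algebraMap_injective F (AlgebraicClosure F)
  have ha2 : a ^ 2 ≠ 1 := by
    apply sq_ne_one_of_trace ha
    rw [← map_pow, ← map_ofNat (algebraMap F (AlgebraicClosure F)), hinj.ne_iff]
    intro h4
    rcases h with h | h
    · have h3 : u = -3 := by linear_combination h - h4
      rw [h3] at h4
      apply h5
      linear_combination h4
    · have h3 : u = 3 := by linear_combination -h + h4
      rw [h3] at h4
      apply h5
      linear_combination h4
  rw [orderOf_pslMk_eq (hu ▸ ha) ha2]
  have := Fact.mk (by norm_num : Nat.Prime 5)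
  refine orderOf_eq_prime ?_ ha2
  set v := algebraMap F (AlgebraicClosure F) u with hv
  have h' : v ^ 2 + v - 1 = 0 ∨ v ^ 2 - v - 1 = 0 := by
    simp only [hv, ← map_pow, ← map_one (algebraMap F (AlgebraicClosure F)), ← map_add, ← map_sub]
    rw [map_eq_zero, map_eq_zero]
    exact h
  have ha0 : a ≠ 0 := by
    rintro rfl
    simp at ha
  have hv' : v = a + a⁻¹ := by
    field_simp
    linear_combination -ha
  rw [hv'] at h'
  rcases h' with h' | h'
  · have : a ^ 4 + a ^ 3 + a ^ 2 + a + 1 = 0 := by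
      field_simp at h'
      linear_combination h'
    linear_combination (a - 1) * (a ^ 5 + 1) * this
  · have : a ^ 4 - a ^ 3 + a ^ 2 - a + 1 = 0 := by
      field_simp at h'
      linear_combination h'
    linear_combination (a + 1) * (a ^ 5 - 1) * this

theorem orderOf_pslMk_eq_four (h2 : (2 : F) ≠ 0) {g : SL(2, F)} {u : F}
    (hu : g 0 0 + g 1 1 = u) (h : u ^ 2 = 2) :
    orderOf (pslMk F g) = 4 := by
  obtain ⟨a, ha⟩ := exists_root_algebraicClosure h2 u
  have hinj := FaithfulSMul.algebraMap_injective F (AlgebraicClosure F)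
  have ha2 : a ^ 2 ≠ 1 := by
    apply sq_ne_one_of_trace ha
    rw [← map_pow, ← map_ofNat (algebraMap F (AlgebraicClosure F)), hinj.ne_iff, h]
    intro h4
    apply h2
    linear_combination -h4
  rw [orderOf_pslMk_eq (hu ▸ ha) ha2]
  set v := algebraMap F (AlgebraicClosure F) u with hv
  have h' : v ^ 2 = 2 := by
    rw [hv, ← map_pow, h, map_ofNat]
  have ha4 : a ^ 4 = -1 := by
    linear_combination (a * a + v * a + 1) * ha + a ^ 2 * h'
  have := orderOf_eq_prime_pow (x := a ^ 2) (p := 2) (n := 1) ?_ ?_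
  · simpa using this
  · rw [← pow_mul]
    norm_num
    rw [ha4, neg_eq_iff_add_eq_zero]
    norm_num
    rw [← map_ofNat (algebraMap F (AlgebraicClosure F)), map_eq_zero]
    exact h2
  · rw [← pow_mul]
    norm_num
    linear_combination (a ^ 4 - 1) * ha4

theorem orderOf_pslMk_of_trace_two {p : ℕ} (hp : p.Prime) [CharP F p] (h2 : (2 : F) ≠ 0)
    {g : SL(2, F)} (hg : g 0 0 + g 1 1 = 2) (hg1 : g ≠ 1) : orderOf (pslMk F g) = p := by
  obtain ⟨w, hw, hgw⟩ := sl2_exists_eigenvector (g := g) (a := 1) (by rw [hg]; ring)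
  rw [one_smul] at hgw
  have := Fact.mk hp
  refine orderOf_eq_prime ?_ ?_
  · obtain ⟨s, rfl⟩ := sl2_exists_smul_single hw
    have h1 : s⁻¹ * g * s = upperUnipotent ((s⁻¹ * g * s) 0 1) := by
      rw [← sl2_smul_single_eq_iff, mul_smul, mul_smul, hgw, inv_smul_smul]
    have h3 : ∀ (b : F) (n : ℕ), upperUnipotent b ^ n = upperUnipotent (n * b) := by
      intro b n
      induction n with
      | zero => apply sl2_ext <;> simp [upperUnipotent_apply]
      | succ n ih =>
        rw [pow_succ, ih]
        apply sl2_ext <;> simp only [sl2_mul_apply, upperUnipotent_apply] <;> push_cast <;> ring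
    have h4 : g = s * upperUnipotent ((s⁻¹ * g * s) 0 1) * s⁻¹ := by
      rw [← h1]; group
    rw [h4, ← map_pow, conj_pow, h3, CharP.cast_eq_zero, zero_mul]
    have : upperUnipotent (0 : F) = 1 := by apply sl2_ext <;> simp [upperUnipotent_apply]
    rw [this]
    simp
  · rw [Ne, pslMk_eq_one_iff, not_or]
    refine ⟨hg1, ?_⟩
    rintro rfl
    simp at hg
    apply mul_self_ne_zero.2 h2
    linear_combination -hg

end Orders

section Existence

variable {F : Type*} [Field F]

/-- The matrix with rows `(a, b)` and `(c, d)`. -/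
def sl2Mk (a b c d : F) (h : a * d - b * c = 1) : SL(2, F) :=
  ⟨!![a, b; c, d], by rw [Matrix.det_fin_two_of, h]⟩

theorem sl2Mk_apply (a b c d : F) (h : a * d - b * c = 1) : sl2Mk a b c d h 0 0 = a ∧
    sl2Mk a b c d h 0 1 = b ∧ sl2Mk a b c d h 1 0 = c ∧ sl2Mk a b c d h 1 1 = d := by
  simp [sl2Mk]

theorem sl2_inv_apply (g : SL(2, F)) : g⁻¹ 0 0 = g 1 1 ∧ g⁻¹ 0 1 = - g 0 1 ∧
    g⁻¹ 1 0 = - g 1 0 ∧ g⁻¹ 1 1 = g 0 0 := by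
  rw [Matrix.SpecialLinearGroup.SL2_inv_expl]
  simp

theorem sl2_trace_mul_inv (A B : SL(2, F)) : (A * B⁻¹) 0 0 + (A * B⁻¹) 1 1 =
    (A 0 0 + A 1 1) * (B 0 0 + B 1 1) - ((A * B) 0 0 + (A * B) 1 1) := by
  simp only [sl2_mul_apply, sl2_inv_apply]
  ring

theorem exists_sl2_traces_two (γ : F) : ∃ A B : SL(2, F), A ≠ 1 ∧ A 0 0 + A 1 1 = 2 ∧
    B 0 0 + B 1 1 = 2 ∧ (A * B) 0 0 + (A * B) 1 1 = γ ∧ (B = 1 → γ = 2) := by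
  refine ⟨upperUnipotent 1, sl2Mk 1 0 (γ - 2) 1 (by ring), ?_, ?_, ?_, ?_, ?_⟩
  · intro h
    have := congrArg (fun M : SL(2, F) => M 0 1) h
    simp [upperUnipotent_apply] at this
  · simp only [upperUnipotent_apply]
    norm_num
  · simp only [sl2Mk_apply]
    norm_num
  · simp only [sl2_mul_apply, upperUnipotent_apply, sl2Mk_apply]
    ring
  · intro h
    have := congrArg (fun M : SL(2, F) => M 1 0) h
    simp [sl2Mk_apply] at this
    linear_combination this

theorem exists_sl2_traces [Finite F] (h2 : (2 : F) ≠ 0) {α : F} (hα : α ^ 2 ≠ 4) (β γ : F) :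
    ∃ A B : SL(2, F), A 0 0 + A 1 1 = α ∧ B 0 0 + B 1 1 = β ∧
      (A * B) 0 0 + (A * B) 1 1 = γ := by
  have := Fintype.ofFinite F
  have h4 : (4 : F) ≠ 0 := by
    have := mul_self_ne_zero.2 h2
    norm_num at this
    exact this
  obtain ⟨z, w, h⟩ : ∃ z w : F, w ^ 2 - α * w * z + z ^ 2 - β * w + γ * z + 1 = 0 := by
    have hlc : 1 - α ^ 2 / 4 ≠ 0 := by
      intro h
      apply hα
      field_simp at h
      linear_combination -h
    obtain ⟨v, z, h⟩ := FiniteField.exists_root_sum_quadratic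
      (f := Polynomial.C (1 : F) * Polynomial.X ^ 2 + Polynomial.C (-β) * Polynomial.X +
        Polynomial.C 1)
      (g := Polynomial.C (1 - α ^ 2 / 4) * Polynomial.X ^ 2 +
        Polynomial.C (γ - α * β / 2) * Polynomial.X + Polynomial.C 0)
      (Polynomial.degree_quadratic one_ne_zero) (Polynomial.degree_quadratic hlc)
      (FiniteField.odd_card_of_char_ne_two fun hch => h2 (by
        have := ringChar.Nat.cast_ringChar (R := F)
        rw [hch] at this
        exact_mod_cast this))
    refine ⟨z, v + α * z / 2, ?_⟩
    simp at h
    field_simp at h ⊢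
    apply mul_left_cancel₀ h2
    linear_combination h
  refine ⟨sl2Mk 0 (-1) 1 α (by ring),
    sl2Mk (β - w) (γ + z - α * w) z w (by linear_combination -h), ?_, ?_, ?_⟩
  · simp only [sl2Mk_apply]
    ring
  · simp only [sl2Mk_apply]
    ring
  · simp only [sl2_mul_apply, sl2Mk_apply]
    ring

end Existence

section QuadraticExtension

variable {F K : Type*} [Field F] [Field K] [Algebra F K] [Fintype F]

theorem mem_range_algebraMap_of_pow_card {x : K} (hx : x ^ Fintype.card F = x) :
    ∃ a : F, algebraMap F K a = x := by
  classical
  have hne : (Polynomial.X ^ Fintype.card F - Polynomial.X : Polynomial K) ≠ 0 :=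
    FiniteField.X_pow_card_sub_X_ne_zero K Fintype.one_lt_card
  have hinj := FaithfulSMul.algebraMap_injective F K
  have hsub : Finset.univ.image (algebraMap F K) ⊆
      (Polynomial.X ^ Fintype.card F - Polynomial.X : Polynomial K).roots.toFinset := by
    intro y hy
    obtain ⟨a, -, rfl⟩ := Finset.mem_image.1 hy
    rw [Multiset.mem_toFinset, Polynomial.mem_roots hne]
    simp [← map_pow, FiniteField.pow_card]
  have heq := Finset.eq_of_subset_of_card_le hsub (by
    rw [Finset.card_image_of_injective _ hinj, Finset.card_univ]
    refine (Multiset.toFinset_card_le _).trans ((Polynomial.card_roots' _).trans ?_)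
    rw [FiniteField.X_pow_card_sub_X_natDegree_eq K Fintype.one_lt_card])
  have hmem : x ∈ (Polynomial.X ^ Fintype.card F - Polynomial.X : Polynomial K).roots.toFinset := by
    rw [Multiset.mem_toFinset, Polynomial.mem_roots hne]
    simp [hx]
  rw [← heq] at hmem
  obtain ⟨a, -, ha⟩ := Finset.mem_image.1 hmem
  exact ⟨a, ha⟩

theorem isSquare_algebraMap_of_card [Fintype K] (h2 : (2 : F) ≠ 0)
    (hK : Fintype.card K = Fintype.card F ^ 2) (hodd : Odd (Fintype.card F)) (a : F) :
    IsSquare (algebraMap F K a) := by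
  by_cases ha : a = 0
  · simp [ha]
  have h2K : (2 : K) ≠ 0 := by
    intro h
    apply h2
    apply FaithfulSMul.algebraMap_injective F K
    rw [map_ofNat, map_zero, h]
  rw [FiniteField.isSquare_iff]
  · obtain ⟨s, hs⟩ := hodd
    have : Fintype.card K / 2 = (Fintype.card F - 1) * (s + 1) := by
      rw [hK, hs]
      have : (2 * s + 1) ^ 2 = 2 * (2 * s * (s + 1)) + 1 := by ring
      rw [this, Nat.add_sub_cancel]
      omega
    rw [this, pow_mul, ← map_pow, FiniteField.pow_card_sub_one_eq_one a ha]
    simp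
  · intro hch
    apply h2K
    have := ringChar.Nat.cast_ringChar (R := K)
    rw [hch] at this
    exact_mod_cast this
  · simpa using ha

theorem exists_orderOf_eq_of_dvd [Fintype K] {n : ℕ} (hn : n ∣ Fintype.card K - 1) :
    ∃ z : K, orderOf z = n := by
  classical
  obtain ⟨g, hg⟩ := IsCyclic.exists_ofOrder_eq_natCard (α := Kˣ)
  rw [Nat.card_eq_fintype_card, Fintype.card_units] at hg
  obtain ⟨m, hm⟩ := hn
  have hpos : 0 < Fintype.card K - 1 := by
    have := Fintype.one_lt_card (α := K)
    omega
  have hm0 : m ≠ 0 := by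
    rintro rfl
    omega
  refine ⟨(g ^ m : Kˣ), ?_⟩
  rw [orderOf_units, orderOf_pow_of_dvd hm0 (by rw [hg, hm]; exact dvd_mul_left _ _), hg, hm,
    Nat.mul_div_cancel _ (Nat.pos_of_ne_zero hm0)]

theorem exists_trace_of_dvd [Fintype K] (hK : Fintype.card K = Fintype.card F ^ 2) {n : ℕ}
    (hn : n = Fintype.card F + 1 ∨ n + 1 = Fintype.card F) (hn0 : n ≠ 0) :
    ∃ z : K, orderOf z = n ∧ ∃ t : F, z * z - algebraMap F K t * z + 1 = 0 := by
  have hfac : Fintype.card K - 1 = (Fintype.card F + 1) * (Fintype.card F - 1) := by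
    rw [hK, ← one_pow 2, Nat.sq_sub_sq, one_pow]
  obtain ⟨z, hz⟩ : ∃ z : K, orderOf z = n := by
    refine exists_orderOf_eq_of_dvd ?_
    rw [hfac]
    rcases hn with h | h
    · rw [h]; exact dvd_mul_right _ _
    · rw [← h]; exact dvd_mul_left _ _
  refine ⟨z, hz, ?_⟩
  have hzn : z ^ n = 1 := hz ▸ pow_orderOf_eq_one z
  have hz0 : z ≠ 0 := by
    rintro rfl
    rw [zero_pow hn0] at hzn
    exact zero_ne_one hzn
  obtain ⟨t, ht⟩ : ∃ t : F, algebraMap F K t = z + z⁻¹ := by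
    rcases hn with h | h
    · have hq : z ^ Fintype.card F = z⁻¹ := by
        rw [h, pow_succ] at hzn
        exact eq_inv_of_mul_eq_one_left hzn
      apply mem_range_algebraMap_of_pow_card
      obtain ⟨p, hp⟩ := CharP.exists F
      obtain ⟨e, hpp, he⟩ := FiniteField.card F p
      have := Fact.mk hpp
      have : CharP K p := charP_of_injective_algebraMap (FaithfulSMul.algebraMap_injective F K) p
      rw [he, add_pow_char_pow, inv_pow, ← he, hq, inv_inv, add_comm]
    · have hq : z ^ Fintype.card F = z := by
        rw [← h, pow_succ, hzn, one_mul]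
      obtain ⟨a, rfl⟩ := mem_range_algebraMap_of_pow_card hq
      exact ⟨a + a⁻¹, by simp⟩
  refine ⟨t, ?_⟩
  rw [ht]
  field_simp
  ring

end QuadraticExtension

section Triples

variable {F : Type*} [Field F] [Fintype F]

variable (F) in
theorem exists_quadratic_extension : ∃ (K : Type) (_ : Field K) (_ : Fintype K) (_ : Algebra F K),
    Fintype.card K = Fintype.card F ^ 2 := by
  obtain ⟨p, hp⟩ := CharP.exists F
  have := Fact.mk (FiniteField.card F p).choose_spec.1
  have := Fintype.ofFinite (FiniteField.Extension F p 2)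
  refine ⟨FiniteField.Extension F p 2, inferInstance, inferInstance, inferInstance, ?_⟩
  have := FiniteField.natCard_extension F p 2
  rwa [Nat.card_eq_fintype_card, Nat.card_eq_fintype_card] at this

theorem psl2_closure_eq_top_or (h2 : (2 : F) ≠ 0) (hodd : Odd (Fintype.card F)) {A B : SL(2, F)}
    {α β γ : F} (hα : A 0 0 + A 1 1 = α) (hβ : B 0 0 + B 1 1 = β)
    (hγ : (A * B) 0 0 + (A * B) 1 1 = γ) (hns : α ^ 2 + β ^ 2 + γ ^ 2 - α * β * γ - 4 ≠ 0)
    (hA : 3 ≤ orderOf (pslMk F A)) (hB : 3 ≤ orderOf (pslMk F B)) {D : SL(2, F)}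
    (hD : pslMk F D ∈ Subgroup.closure {pslMk F A, pslMk F B}) {r : ℕ}
    (hDr : orderOf (pslMk F D) = r) (hr : 4 ≤ r)
    (hrq : 2 * r = Fintype.card F + 1 ∨ 2 * r + 1 = Fintype.card F) :
    Subgroup.closure {pslMk F A, pslMk F B} = ⊤ ∨
      (r = 4 ∧ ∀ g, pslMk F g ∈ Subgroup.closure {pslMk F A, pslMk F B} →
        orderOf (pslMk F g) ∣ 48) ∨
      (r = 5 ∧ ∀ g, pslMk F g ∈ Subgroup.closure {pslMk F A, pslMk F B} →
        orderOf (pslMk F g) ∣ 120) := by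
  obtain ⟨K, _, _, _, hK⟩ := exists_quadratic_extension F
  have hsq : ∀ a : F, IsSquare (algebraMap F K a) := isSquare_algebraMap_of_card h2 hK hodd
  set G := Subgroup.closure {pslMk F A, pslMk F B} with hG
  let H := G.comap (pslMk F)
  have hAH : A ∈ H := Subgroup.subset_closure (by simp)
  have hBH : B ∈ H := Subgroup.subset_closure (by simp)
  have hneg1 : pslMk F (-1) = 1 := (pslMk_eq_one_iff _).2 (Or.inr rfl)
  have hneg : -1 ∈ H := by
    rw [Subgroup.mem_comap, hneg1]
    exact one_mem G
  obtain ⟨c, hcD, hc⟩ := exists_orderOf_eq_two_mul h2 hDr (by omega)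
  have hcH : c ∈ H := by
    rw [Subgroup.mem_comap]
    rcases hcD with rfl | rfl
    · exact hD
    · rw [pslMk_neg]
      exact hD
  have hsl2neg : sl2Map F K (-1) = -1 := by apply sl2_ext <;> simp [sl2Map_apply]
  have h2K : (2 : K) ≠ 0 := by
    intro h
    apply h2
    apply FaithfulSMul.algebraMap_injective F K
    rw [map_ofNat, map_zero, h]
  have hlarge : ∀ g : SL(2, F), g ∈ H → 3 ≤ orderOf (pslMk F g) → ∀ x : ℙ K (Fin 2 → K),
      sl2Map F K g • x ≠ x → 3 ≤ Nat.card (orbit (H.map (sl2Map F K)) x) := by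
    intro g hg h3 x hx
    have hpow : ¬ (g ^ 2 = 1 ∨ g ^ 2 = -1) := by
      intro h
      rw [← pslMk_eq_one_iff, map_pow] at h
      have := Nat.le_of_dvd two_pos (orderOf_dvd_of_pow_eq_one h)
      omega
    rw [not_or] at hpow
    refine three_le_card_orbit_of_smul_ne (Subgroup.mem_map_of_mem _ hg) ?_ ?_ ?_ hx
    · simp only [sl2Map_apply, ← map_add]
      exact exists_root_of_isSquare h2K hsq _
    · rw [← map_pow, ← map_one (sl2Map F K), sl2Map_injective.ne_iff]
      exact hpow.1
    · rw [← map_pow, ← hsl2neg, sl2Map_injective.ne_iff]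
      exact hpow.2
  have horb : ∀ x : ℙ K (Fin 2 → K), 3 ≤ Nat.card (orbit (H.map (sl2Map F K)) x) := by
    intro x
    by_cases hAx : sl2Map F K A • x = x
    · refine hlarge B hBH hB x fun hBx => hns ?_
      apply FaithfulSMul.algebraMap_injective F K
      have := sl2_trace_relation_of_common_fixed_point hAx hBx (α := algebraMap F K α)
        (β := algebraMap F K β) (γ := algebraMap F K γ)
        (by rw [← hα, sl2Map_apply, sl2Map_apply, map_add])
        (by rw [← hβ, sl2Map_apply, sl2Map_apply, map_add])
        (by rw [← map_mul, ← hγ, sl2Map_apply, sl2Map_apply, map_add])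
      simpa [map_ofNat (algebraMap F K) 4] using this
    · exact hlarge A hAH hA x hAx
  have horder : ∀ n, Nat.card H = n → ∀ g, pslMk F g ∈ G → orderOf (pslMk F g) ∣ n := by
    rintro n rfl g hg
    refine (orderOf_map_dvd (pslMk F) g).trans ?_
    exact Subgroup.orderOf_dvd_natCard H hg
  rcases sl2_subgroup_eq_top_or (K := K) h2 hsq hneg horb hcH hc hr
    (by rwa [Nat.card_eq_fintype_card]) with h | ⟨h, h'⟩ | ⟨h, h'⟩
  · left
    rw [Subgroup.eq_top_iff'] at h ⊢
    intro x
    obtain ⟨g, rfl⟩ := pslMk_surjective x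
    exact h g
  · exact Or.inr (Or.inl ⟨h, horder _ h'⟩)
  · exact Or.inr (Or.inr ⟨h, horder _ h'⟩)

/-- There is an element of `F` such that all elements of `SL₂(F)` with this trace have order `r` in
`PSL₂(F)`. -/
theorem exists_trace_orderOf {r : ℕ} (hr : 4 ≤ r)
    (hrq : 2 * r = Fintype.card F + 1 ∨ 2 * r + 1 = Fintype.card F) :
    ∃ t : F, t ^ 2 ≠ 4 ∧ t ≠ -1 ∧ (r = 4 → t ^ 2 = 2) ∧ (r = 5 → t ^ 2 - t - 1 = 0) ∧
      ∀ g : SL(2, F), g 0 0 + g 1 1 = t → orderOf (pslMk F g) = r := by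
  obtain ⟨K, _, _, _, hK⟩ := exists_quadratic_extension F
  have hinj := FaithfulSMul.algebraMap_injective F K
  obtain ⟨z, hz, t, ht⟩ := exists_trace_of_dvd hK hrq (by omega)
  have hpow : ∀ n, n ≠ 0 → n < 2 * r → z ^ n ≠ 1 := by
    intro n hn hlt h
    have := Nat.le_of_dvd (Nat.pos_of_ne_zero hn) (orderOf_dvd_of_pow_eq_one h)
    omega
  have hz0 : z ≠ 0 := by
    rintro rfl
    simp at ht
  have hzr : z ^ r = -1 := by
    have h1 : z ^ r * z ^ r = 1 := by
      rw [← pow_add, ← two_mul, ← hz, pow_orderOf_eq_one]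
    exact (mul_self_eq_one_iff.1 h1).resolve_left (hpow r (by omega) (by omega))
  set v := algebraMap F K t with hv
  have hvz : v = z + z⁻¹ := by
    field_simp
    linear_combination -ht
  refine ⟨t, ?_, ?_, ?_, ?_, ?_⟩
  · intro h
    have hv4 : v ^ 2 = 4 := by rw [hv, ← map_pow, h, map_ofNat]
    rw [hvz] at hv4
    field_simp at hv4
    have : (z ^ 2 - 1) ^ 2 = 0 := by linear_combination hv4
    exact hpow 2 (by omega) (by omega) (sub_eq_zero.1 (pow_eq_zero_iff two_ne_zero |>.1 this))
  · rintro rfl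
    have hv1 : v = -1 := by rw [hv, map_neg, map_one]
    rw [hv1] at ht
    apply hpow 3 (by omega) (by omega)
    linear_combination (z - 1) * ht
  · rintro rfl
    apply hinj
    rw [map_pow, ← hv, hvz, map_ofNat]
    field_simp
    linear_combination hzr
  · rintro rfl
    apply hinj
    rw [map_sub, map_sub, map_pow, ← hv, hvz, map_one, map_zero]
    have hz1 : z + 1 ≠ 0 := by
      intro h
      apply hpow 2 (by omega) (by omega)
      linear_combination (z - 1) * h
    have : z ^ 4 - z ^ 3 + z ^ 2 - z + 1 = 0 := by
      apply mul_left_cancel₀ hz1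
      linear_combination hzr
    field_simp
    linear_combination this
  · intro g hg
    rw [orderOf_pslMk_eq (a := z) (by rw [hg]; exact ht) (hpow 2 (by omega) (by omega)),
      orderOf_pow_of_dvd two_ne_zero (by rw [hz]; exact dvd_mul_right _ _), hz,
      Nat.mul_div_cancel_left _ two_pos]

end Triples

section GeneratingPairs

variable {F : Type*} [Field F]

theorem pslMk_left_mem_closure (A B : SL(2, F)) :
    pslMk F A ∈ Subgroup.closure {pslMk F A, pslMk F B} :=
  Subgroup.subset_closure (by simp)

theorem pslMk_right_mem_closure (A B : SL(2, F)) :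
    pslMk F B ∈ Subgroup.closure {pslMk F A, pslMk F B} :=
  Subgroup.subset_closure (by simp)

theorem pslMk_mul_mem_closure (A B : SL(2, F)) :
    pslMk F (A * B) ∈ Subgroup.closure {pslMk F A, pslMk F B} := by
  rw [map_mul]
  exact mul_mem (pslMk_left_mem_closure A B) (pslMk_right_mem_closure A B)

theorem pslMk_mul_inv_mem_closure (A B : SL(2, F)) :
    pslMk F (A * B⁻¹) ∈ Subgroup.closure {pslMk F A, pslMk F B} := by
  rw [map_mul, map_inv]
  exact mul_mem (pslMk_left_mem_closure A B) (inv_mem (pslMk_right_mem_closure A B))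

theorem sl2_trace_neg {A : SL(2, F)} {α : F} (h : A 0 0 + A 1 1 = α) :
    (-A) 0 0 + (-A) 1 1 = -α := by
  rw [← h]
  simp
  ring

theorem five_ne_zero_of_three_eq_zero (h2 : (2 : F) ≠ 0) (h3 : (3 : F) = 0) : (5 : F) ≠ 0 :=
  fun h => h2 (by linear_combination h - h3)

variable [Fintype F]

theorem three_eq_zero_of_card_eq_nine (h : Fintype.card F = 9) : (3 : F) = 0 := by
  have := FiniteField.cast_card_eq_zero F
  rw [h] at this
  have h9 : (3 : F) * 3 = 0 := by
    linear_combination this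
  exact mul_self_eq_zero.1 h9

theorem exists_generating_pair_equal_orders {p : ℕ} (hp : p.Prime) [CharP F p]
    (h2 : (2 : F) ≠ 0) (hodd : Odd (Fintype.card F)) (hcard : 7 < Fintype.card F) {r : ℕ}
    (hr : 4 ≤ r) (hrq : 2 * r = Fintype.card F + 1 ∨ 2 * r + 1 = Fintype.card F) :
    ∃ A B : SL(2, F), Subgroup.closure {pslMk F A, pslMk F B} = ⊤ ∧ orderOf (pslMk F A) = r ∧
      orderOf (pslMk F B) = r ∧ orderOf (pslMk F (A * B)) = r := by
  obtain ⟨t, ht4, ht1, htr4, htr5, ht⟩ := exists_trace_orderOf (F := F) hr hrq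
  by_cases h9 : r = 5 ∧ Fintype.card F = 9
  · obtain ⟨rfl, hc⟩ := h9
    have h3 := three_eq_zero_of_card_eq_nine hc
    have h5 := five_ne_zero_of_three_eq_zero h2 h3
    have h := htr5 rfl
    obtain ⟨A, B, hA, hB, hAB⟩ := exists_sl2_traces h2 (α := -t) (by rwa [neg_sq]) (t - 1) t
    have oA := orderOf_pslMk_eq_five h2 h5 hA (Or.inl (by linear_combination h))
    have oB := orderOf_pslMk_eq_five h2 h5 hB (Or.inl (by linear_combination h))
    have oAB := orderOf_pslMk_eq_five h2 h5 hAB (Or.inr h)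
    refine ⟨A, B, ?_, oA, oB, oAB⟩
    have ht0 : t ≠ 0 := by
      rintro rfl
      simp at h
    have oD : orderOf (pslMk F (A * B⁻¹)) = 4 := by
      apply orderOf_pslMk_eq_four h2 (u := -1 - t)
      · rw [sl2_trace_mul_inv, hA, hB, hAB]
        linear_combination -h
      · linear_combination h + t * h3
    have hns : (-t) ^ 2 + (t - 1) ^ 2 + t ^ 2 - -t * (t - 1) * t - 4 ≠ 0 := by
      intro h0
      apply mul_ne_zero h2 ht0
      linear_combination h0 - (t + 3) * h
    rcases psl2_closure_eq_top_or h2 hodd hA hB hAB hns (by omega) (by omega)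
      (pslMk_mul_inv_mem_closure A B) oD le_rfl (by omega) with h | ⟨-, h⟩ | ⟨h, -⟩
    · exact h
    · have := h A (pslMk_left_mem_closure A B)
      rw [oA] at this
      norm_num at this
    · norm_num at h
  by_cases h11 : r = 5
  · have hc : Fintype.card F = 11 := by omega
    subst h11
    have hcz : (11 : F) = 0 := by
      have := FiniteField.cast_card_eq_zero F
      rw [hc] at this
      exact_mod_cast this
    have h5 : (5 : F) ≠ 0 := fun h => one_ne_zero (α := F) (by linear_combination hcz - 2 * h)
    have h7 : (7 : F) ≠ 0 := fun h => one_ne_zero (α := F) (by linear_combination 2 * hcz - 3 * h)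
    have hp11 : p = 11 := by
      have := (CharP.cast_eq_zero_iff F p 11).1 (by exact_mod_cast hcz)
      exact (Nat.prime_dvd_prime_iff_eq hp (by norm_num)).1 this
    obtain ⟨A, B, hA, hB, hAB⟩ := exists_sl2_traces h2 (α := (3 : F))
      (fun h => h5 (by linear_combination h)) 4 3
    have oA := orderOf_pslMk_eq_five h2 h5 hA (Or.inl (by linear_combination hcz))
    have oB := orderOf_pslMk_eq_five h2 h5 hB (Or.inr (by linear_combination hcz))
    have oAB := orderOf_pslMk_eq_five h2 h5 hAB (Or.inl (by linear_combination hcz))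
    refine ⟨A, B, ?_, oA, oB, oAB⟩
    have oD : orderOf (pslMk F (A * B⁻¹)) = 11 := by
      rw [← pslMk_neg, ← hp11]
      apply orderOf_pslMk_of_trace_two hp h2
      · rw [sl2_trace_neg rfl, sl2_trace_mul_inv, hA, hB, hAB]
        linear_combination -hcz
      · intro h
        have hAB' : A = -B := by
          rw [neg_eq_iff_eq_neg, mul_inv_eq_iff_eq_mul, neg_one_mul] at h
          exact h
        rw [hAB', sl2_trace_neg hB] at hA
        apply h7
        linear_combination -hA
    have hns : (3 : F) ^ 2 + 4 ^ 2 + 3 ^ 2 - 3 * 4 * 3 - 4 ≠ 0 := fun h0 =>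
      h5 (by linear_combination h0 + hcz)
    rcases psl2_closure_eq_top_or h2 hodd hA hB hAB hns (by omega) (by omega)
      (pslMk_left_mem_closure A B) oA hr hrq with h | ⟨h, -⟩ | ⟨-, h⟩
    · exact h
    · norm_num at h
    · have := h _ (pslMk_mul_inv_mem_closure A B)
      rw [oD] at this
      norm_num at this
  obtain ⟨A, B, hA, hB, hAB⟩ := exists_sl2_traces h2 ht4 t t
  have oA := ht A hA
  refine ⟨A, B, ?_, oA, ht B hB, ht _ hAB⟩
  have hns : t ^ 2 + t ^ 2 + t ^ 2 - t * t * t - 4 ≠ 0 := by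
    intro h0
    have : (t + 1) * (t - 2) ^ 2 = 0 := by linear_combination -h0
    rcases mul_eq_zero.1 this with h | h
    · exact ht1 (by linear_combination h)
    · exact ht4 (by linear_combination (t + 2) * (pow_eq_zero_iff two_ne_zero).1 h)
  rcases psl2_closure_eq_top_or h2 hodd hA hB hAB hns (by omega) (by rw [ht B hB]; omega)
    (pslMk_left_mem_closure A B) oA hr hrq with h | ⟨rfl, h⟩ | ⟨h, -⟩
  · exact h
  · have h3 := three_eq_zero_of_card_eq_nine (F := F) (by omega)
    have h5 := five_ne_zero_of_three_eq_zero h2 h3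
    have oD : orderOf (pslMk F (A * B⁻¹)) = 5 := by
      apply orderOf_pslMk_eq_five h2 h5 (u := -1 - t)
      · rw [sl2_trace_mul_inv, hA, hB, hAB]
        linear_combination htr4 rfl + h3
      · right
        linear_combination htr4 rfl + t * h3 + h3
    have := h _ (pslMk_mul_inv_mem_closure A B)
    rw [oD] at this
    norm_num at this
  · exact absurd h h11

theorem exists_generating_pair_unipotent {p : ℕ} (hp : p.Prime) [CharP F p]
    (h2 : (2 : F) ≠ 0) (hodd : Odd (Fintype.card F)) (hcard : 7 < Fintype.card F) {r : ℕ}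
    (hr : 4 ≤ r) (hrq : 2 * r = Fintype.card F + 1 ∨ 2 * r + 1 = Fintype.card F) :
    ∃ A B : SL(2, F), Subgroup.closure {pslMk F A, pslMk F B} = ⊤ ∧ orderOf (pslMk F A) = p ∧
      orderOf (pslMk F B) = p ∧ orderOf (pslMk F (A * B)) = r := by
  obtain ⟨t, ht4, -, htr4, htr5, ht⟩ := exists_trace_orderOf (F := F) hr hrq
  have hp3 : 3 ≤ p := by
    have := hp.two_le
    have : p ≠ 2 := by
      rintro rfl
      exact h2 (by exact_mod_cast CharP.cast_eq_zero F 2)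
    omega
  have key : ∀ γ : F, γ ^ 2 ≠ 4 → ∃ A B : SL(2, F), orderOf (pslMk F A) = p ∧
      orderOf (pslMk F B) = p ∧ (A * B) 0 0 + (A * B) 1 1 = γ ∧
      (A * B⁻¹) 0 0 + (A * B⁻¹) 1 1 = 4 - γ ∧
      ∀ D : SL(2, F), pslMk F D ∈ Subgroup.closure {pslMk F A, pslMk F B} → ∀ r,
      orderOf (pslMk F D) = r → 4 ≤ r → (2 * r = Fintype.card F + 1 ∨ 2 * r + 1 = Fintype.card F) →
      Subgroup.closure {pslMk F A, pslMk F B} = ⊤ ∨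
      (r = 4 ∧ ∀ g, pslMk F g ∈ Subgroup.closure {pslMk F A, pslMk F B} →
        orderOf (pslMk F g) ∣ 48) ∨
      (r = 5 ∧ ∀ g, pslMk F g ∈ Subgroup.closure {pslMk F A, pslMk F B} →
        orderOf (pslMk F g) ∣ 120) := by
    intro γ hγ
    have hγ2 : γ ≠ 2 := by
      rintro rfl
      norm_num at hγ
    obtain ⟨A, B, hA1, hA, hB, hAB, hB1⟩ := exists_sl2_traces_two γ
    have oA := orderOf_pslMk_of_trace_two hp h2 hA hA1
    have oB := orderOf_pslMk_of_trace_two hp h2 hB (fun h => hγ2 (hB1 h))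
    refine ⟨A, B, oA, oB, hAB, by rw [sl2_trace_mul_inv, hA, hB, hAB]; ring, ?_⟩
    intro D hD r hDr hr hrq
    refine psl2_closure_eq_top_or h2 hodd hA hB hAB ?_ (by omega) (by omega) hD hDr hr hrq
    intro h
    apply pow_ne_zero 2 (sub_ne_zero.2 hγ2)
    linear_combination h
  by_cases h9 : r = 5 ∧ Fintype.card F = 9
  · obtain ⟨rfl, hc⟩ := h9
    have h3 := three_eq_zero_of_card_eq_nine hc
    obtain ⟨A, B, oA, oB, hAB, hAB', h⟩ := key (-t) (by rwa [neg_sq])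
    have oAB : orderOf (pslMk F (A * B)) = 5 := by
      rw [← pslMk_neg]
      apply ht
      rw [sl2_trace_neg hAB, neg_neg]
    refine ⟨A, B, ?_, oA, oB, oAB⟩
    have oD : orderOf (pslMk F (A * B⁻¹)) = 4 := by
      apply orderOf_pslMk_eq_four h2 hAB'
      linear_combination htr5 rfl + (3 * t + 5) * h3
    rcases h _ (pslMk_mul_inv_mem_closure A B) 4 oD le_rfl (by omega) with h | ⟨-, h⟩ | ⟨h, -⟩
    · exact h
    · have := h _ (pslMk_mul_mem_closure A B)
      rw [oAB] at this
      norm_num at this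
    · norm_num at h
  obtain ⟨A, B, oA, oB, hAB, hAB', h⟩ := key t ht4
  have oAB := ht _ hAB
  refine ⟨A, B, ?_, oA, oB, oAB⟩
  rcases h _ (pslMk_mul_mem_closure A B) r oAB hr hrq with h | ⟨rfl, h⟩ | ⟨rfl, h⟩
  · exact h
  · have h3 := three_eq_zero_of_card_eq_nine (F := F) (by omega)
    have h5 := five_ne_zero_of_three_eq_zero h2 h3
    have oD : orderOf (pslMk F (A * B⁻¹)) = 5 := by
      apply orderOf_pslMk_eq_five h2 h5 hAB'
      left
      linear_combination htr4 rfl + (7 - 3 * t) * h3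
    have := h _ (pslMk_mul_inv_mem_closure A B)
    rw [oD] at this
    norm_num at this
  · have hc : Fintype.card F = 11 := by omega
    have hp11 : p = 11 := by
      have := FiniteField.cast_card_eq_zero F
      rw [hc, CharP.cast_eq_zero_iff F p] at this
      exact (Nat.prime_dvd_prime_iff_eq hp (by norm_num)).1 this
    have := h _ (pslMk_left_mem_closure A B)
    rw [oA, hp11] at this
    norm_num at this

end GeneratingPairs

section Assembly

theorem orderOf_dvd_of_mem_conjPowers {G : Type*} [Group G] {a x : G} (h : x ∈ conjPowers a) :
    orderOf x ∣ orderOf a := by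
  obtain ⟨g, j, rfl⟩ := h
  rw [← MulAut.conj_apply, MulEquiv.orderOf_eq]
  exact orderOf_pow_dvd j

theorem one_mem_conjPowers {G : Type*} [Group G] (a : G) : (1 : G) ∈ conjPowers a :=
  ⟨1, 0, by simp⟩

theorem hasBeauvilleOfType_of_coprime {G : Type*} [Group G] {a₁ b₁ a₂ b₂ : G} {p r s : ℕ}
    (h₁ : Subgroup.closure {a₁, b₁} = ⊤) (h₂ : Subgroup.closure {a₂, b₂} = ⊤)
    (ha₁ : orderOf a₁ = p) (hb₁ : orderOf b₁ = p) (hc₁ : orderOf (a₁ * b₁) = r)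
    (ha₂ : orderOf a₂ = s) (hb₂ : orderOf b₂ = s) (hc₂ : orderOf (a₂ * b₂) = s)
    (hps : p.Coprime s) (hrs : r.Coprime s) : HasBeauvilleOfType G p p r s s s := by
  refine ⟨a₁, b₁, (a₁ * b₁)⁻¹, a₂, b₂, (a₂ * b₂)⁻¹,
    ⟨mul_inv_cancel _, mul_inv_cancel _, h₁, h₂, ?_⟩, ha₁, hb₁, by rwa [orderOf_inv], ha₂, hb₂,
    by rwa [orderOf_inv]⟩
  apply Set.eq_singleton_iff_unique_mem.2
  refine ⟨⟨Or.inl (Or.inl (one_mem_conjPowers _)), Or.inl (Or.inl (one_mem_conjPowers _))⟩, ?_⟩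
  rintro x ⟨hx₁, hx₂⟩
  have hs : orderOf x ∣ s := by
    rcases hx₂ with (h | h) | h
    · exact ha₂ ▸ orderOf_dvd_of_mem_conjPowers h
    · exact hb₂ ▸ orderOf_dvd_of_mem_conjPowers h
    · simpa only [orderOf_inv, hc₂] using orderOf_dvd_of_mem_conjPowers h
  rw [← orderOf_eq_one_iff]
  rcases hx₁ with (h | h) | h
  · exact Nat.eq_one_of_dvd_coprimes hps (ha₁ ▸ orderOf_dvd_of_mem_conjPowers h) hs
  · exact Nat.eq_one_of_dvd_coprimes hps (hb₁ ▸ orderOf_dvd_of_mem_conjPowers h) hs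
  · exact Nat.eq_one_of_dvd_coprimes hrs
      (by simpa only [orderOf_inv, hc₁] using orderOf_dvd_of_mem_conjPowers h) hs

end Assembly

/-- Let `q = p ^ e > 7` be an odd prime power.  Then `PSL₂(q)` admits
unmixed Beauville structures of types `((p, p, (q-1)/2), ((q+1)/2, (q+1)/2, (q+1)/2))` and
`((p, p, (q+1)/2), ((q-1)/2, (q-1)/2, (q-1)/2))`. -/
theorem beauville_types_pp_PSL2 (p e : ℕ) (hp : p.Prime) (hodd : Odd p) (he : 0 < e)
    (hq : 7 < p ^ e)
    (F : Type*) [Field F] [Fintype F] (hF : Fintype.card F = p ^ e) :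
    HasBeauvilleOfType (PSL2 F) p p ((p ^ e - 1) / 2)
      ((p ^ e + 1) / 2) ((p ^ e + 1) / 2) ((p ^ e + 1) / 2) ∧
    HasBeauvilleOfType (PSL2 F) p p ((p ^ e + 1) / 2)
      ((p ^ e - 1) / 2) ((p ^ e - 1) / 2) ((p ^ e - 1) / 2) := by
  have := Fact.mk hp
  have : CharP F p := charP_of_card_eq_prime_pow hF
  have h2 : (2 : F) ≠ 0 := by
    intro h
    have : p ∣ 2 := (CharP.cast_eq_zero_iff F p 2).1 (by exact_mod_cast h)
    rw [(Nat.prime_dvd_prime_iff_eq hp Nat.prime_two).1 this] at hodd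
    exact absurd hodd (by decide)
  have hdvd : p ∣ p ^ e := dvd_pow_self p he.ne'
  have hqodd : Odd (Fintype.card F) := hF ▸ hodd.pow
  have hcard : 7 < Fintype.card F := hF ▸ hq
  rw [← hF] at hdvd ⊢
  generalize hqF : Fintype.card F = q at *
  obtain ⟨n, rfl⟩ := hqodd
  have e₁ : (2 * n + 1 - 1) / 2 = n := by omega
  have e₂ : (2 * n + 1 + 1) / 2 = n + 1 := by omega
  rw [e₁, e₂]
  have hn : n.Coprime (n + 1) := by simp
  have hpn : p.Coprime n := (Nat.Prime.coprime_iff_not_dvd hp).2 fun h =>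
    hp.one_lt.ne' (Nat.dvd_one.1 ((Nat.dvd_add_right (h.mul_left 2)).1 hdvd))
  have hpn' : p.Coprime (n + 1) := (Nat.Prime.coprime_iff_not_dvd hp).2 fun h => by
    have h' : p ∣ 2 * n + 1 + 1 := h.mul_left 2
    exact hp.one_lt.ne' (Nat.dvd_one.1 ((Nat.dvd_add_right hdvd).1 h'))
  have hX := fun r hr hrq => exists_generating_pair_equal_orders hp h2 (hqF ▸ ⟨n, rfl⟩)
    (hqF ▸ hcard) (r := r) hr hrq
  have hY := fun r hr hrq => exists_generating_pair_unipotent hp h2 (hqF ▸ ⟨n, rfl⟩)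
    (hqF ▸ hcard) (r := r) hr hrq
  constructor
  · obtain ⟨A₁, B₁, h₁, a₁, b₁, c₁⟩ := hY n (by omega) (by omega)
    obtain ⟨A₂, B₂, h₂, a₂, b₂, c₂⟩ := hX (n + 1) (by omega) (by omega)
    rw [map_mul] at c₁ c₂
    exact hasBeauvilleOfType_of_coprime h₁ h₂ a₁ b₁ c₁ a₂ b₂ c₂ hpn' hn
  · obtain ⟨A₁, B₁, h₁, a₁, b₁, c₁⟩ := hY (n + 1) (by omega) (by omega)
    obtain ⟨A₂, B₂, h₂, a₂, b₂, c₂⟩ := hX n (by omega) (by omega)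
    rw [map_mul] at c₁ c₂
    exact hasBeauvilleOfType_of_coprime h₁ h₂ a₁ b₁ c₁ a₂ b₂ c₂ hpn hn.symm
end

section
/- For every odd prime power q ≥ 5, the group PGL₂(q) admits an unmixed Beauville structure. -/
open Matrix

/-- The projective general linear group `PGL₂(F) = GL(2, F) / Z(GL(2, F))`. -/
abbrev PGL2 (F : Type*) [Field F] :=
  Matrix.GeneralLinearGroup (Fin 2) F ⧸ Subgroup.center (Matrix.GeneralLinearGroup (Fin 2) F)

section DiscriminantClass

variable {F : Type*} [Field F]

lemma discr_smul_add_smul_one (A : Matrix (Fin 2) (Fin 2) F) (α β : F) :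
    (α • A + β • (1 : Matrix (Fin 2) (Fin 2) F)).discr = α ^ 2 * A.discr := by
  simp [Matrix.discr_fin_two, Matrix.det_fin_two, Matrix.trace_fin_two]
  ring

lemma exists_pow_eq_smul_add_smul_one (A : Matrix (Fin 2) (Fin 2) F) (j : ℕ) :
    ∃ α β : F, A ^ j = α • A + β • (1 : Matrix (Fin 2) (Fin 2) F) := by
  induction j with
  | zero => exact ⟨0, 1, by simp⟩
  | succ j ih =>
    obtain ⟨α, β, h⟩ := ih
    refine ⟨α * A.trace + β, -(α * A.det), ?_⟩
    rw [pow_succ, h]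
    ext i k
    fin_cases i <;> fin_cases k <;>
      simp [Matrix.mul_apply, Fin.sum_univ_two, Matrix.det_fin_two, Matrix.trace_fin_two] <;> ring

lemma discr_inv (g : GL (Fin 2) F) :
    (g⁻¹).val.discr = (g.val.det⁻¹) ^ 2 * g.val.discr := by
  have h : g.val.det ≠ 0 := g.det.ne_zero
  rw [Matrix.coe_units_inv, Matrix.inv_def, Ring.inverse_eq_inv',
    Matrix.adjugate_fin_two, Matrix.discr_fin_two, Matrix.discr_fin_two]
  rw [Matrix.det_fin_two] at h
  simp [Matrix.det_fin_two, Matrix.trace_fin_two]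
  field_simp
  ring

lemma mk_eq_one_of_val_eq_smul_one {g : GL (Fin 2) F} {β : F} (h : g.val = β • 1) :
    (g : PGL2 F) = 1 := by
  rw [QuotientGroup.eq_one_iff, Matrix.GeneralLinearGroup.mem_center_iff_val_mem_range_scalar]
  exact ⟨β, by rw [h, Matrix.scalar_apply, Matrix.smul_one_eq_diagonal]⟩

/-- An element of `PGL₂(F)` is split if the characteristic polynomial of a matrix representing it
has square discriminant. -/
def IsSplit (x : PGL2 F) : Prop :=
  ∃ g : GL (Fin 2) F, (g : PGL2 F) = x ∧ IsSquare g.val.discr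

lemma isSplit_mk_iff {g : GL (Fin 2) F} : IsSplit (g : PGL2 F) ↔ IsSquare g.val.discr := by
  refine ⟨?_, fun h => ⟨g, rfl, h⟩⟩
  rintro ⟨k, hk, r, hr⟩
  rw [QuotientGroup.eq, Matrix.GeneralLinearGroup.mem_center_iff_val_mem_range_scalar] at hk
  obtain ⟨c, hc⟩ := hk
  have hg : g.val = c • k.val + (0 : F) • (1 : Matrix (Fin 2) (Fin 2) F) := by
    have : g = k * (k⁻¹ * g) := by group
    rw [this, Units.val_mul, ← hc, Matrix.scalar_apply, ← Matrix.smul_one_eq_diagonal]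
    simp
  rw [hg, discr_smul_add_smul_one, hr]
  exact ⟨c * r, by ring⟩

lemma IsSplit.inv {x : PGL2 F} (hx : IsSplit x) : IsSplit x⁻¹ := by
  obtain ⟨g, rfl, r, hr⟩ := hx
  refine ⟨g⁻¹, rfl, g.val.det⁻¹ * r, ?_⟩
  rw [discr_inv, hr]
  ring

lemma IsSplit.pow {x : PGL2 F} (hx : IsSplit x) (j : ℕ) : IsSplit (x ^ j) := by
  obtain ⟨g, rfl, r, hr⟩ := hx
  obtain ⟨α, β, h⟩ := exists_pow_eq_smul_add_smul_one g.val j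
  refine ⟨g ^ j, rfl, α * r, ?_⟩
  rw [Units.val_pow_eq_pow_val, h, discr_smul_add_smul_one, hr]
  ring

lemma IsSplit.conj {x : PGL2 F} (hx : IsSplit x) (y : PGL2 F) : IsSplit (y * x * y⁻¹) := by
  obtain ⟨g, rfl, hg⟩ := hx
  induction y using QuotientGroup.induction_on with
  | H k =>
    refine ⟨k * g * k⁻¹, rfl, ?_⟩
    rwa [Units.val_mul, Units.val_mul, Matrix.coe_units_inv, Matrix.discr_conj]

lemma IsSplit.of_mem_conjPowers {x y : PGL2 F} (hx : IsSplit x) (hy : y ∈ conjPowers x) :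
    IsSplit y := by
  obtain ⟨g, j, rfl⟩ := hy
  exact (hx.pow j).conj g

lemma pow_eq_one_of_isSplit_pow {x : PGL2 F} (hx : ¬ IsSplit x) {j : ℕ}
    (hj : IsSplit (x ^ j)) : x ^ j = 1 := by
  induction x using QuotientGroup.induction_on with
  | H g =>
    rw [isSplit_mk_iff] at hx
    rw [← QuotientGroup.mk_pow, isSplit_mk_iff] at hj
    obtain ⟨α, β, h⟩ := exists_pow_eq_smul_add_smul_one g.val j
    rw [Units.val_pow_eq_pow_val, h, discr_smul_add_smul_one] at hj
    have hα : α = 0 := by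
      by_contra hα
      refine hx ?_
      obtain ⟨r, hr⟩ := hj
      refine ⟨α⁻¹ * r, ?_⟩
      field_simp
      linear_combination hr
    rw [← QuotientGroup.mk_pow]
    refine mk_eq_one_of_val_eq_smul_one (β := β) ?_
    rw [Units.val_pow_eq_pow_val, h, hα]
    simp

lemma eq_one_of_mem_conjPowers {x y : PGL2 F} (hx : ¬ IsSplit x) (hy : y ∈ conjPowers x)
    (hs : IsSplit y) : y = 1 := by
  obtain ⟨g, j, rfl⟩ := hy
  have h : IsSplit (x ^ j) := by simpa [mul_assoc] using hs.conj g⁻¹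
  simp [pow_eq_one_of_isSplit_pow hx h]

lemma sigma3_inter_sigma3_eq_one {a₁ b₁ c₁ a₂ b₂ c₂ : PGL2 F}
    (ha₁ : IsSplit a₁) (hb₁ : IsSplit b₁) (hc₁ : IsSplit c₁)
    (ha₂ : ¬ IsSplit a₂) (hb₂ : ¬ IsSplit b₂) (hc₂ : ¬ IsSplit c₂) :
    sigma3 a₁ b₁ c₁ ∩ sigma3 a₂ b₂ c₂ = {1} := by
  refine Set.Subset.antisymm ?_ ?_
  · rintro x ⟨h₁, h₂⟩
    have hx : IsSplit x := by
      rcases h₁ with (h | h) | h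
      · exact ha₁.of_mem_conjPowers h
      · exact hb₁.of_mem_conjPowers h
      · exact hc₁.of_mem_conjPowers h
    rcases h₂ with (h | h) | h
    · exact eq_one_of_mem_conjPowers ha₂ h hx
    · exact eq_one_of_mem_conjPowers hb₂ h hx
    · exact eq_one_of_mem_conjPowers hc₂ h hx
  · have h (a : PGL2 F) : (1 : PGL2 F) ∈ conjPowers a := ⟨1, 0, by simp⟩
    rintro _ rfl
    exact ⟨Or.inr (h _), Or.inr (h _)⟩

lemma isUnmixedBeauville_of_isSplit {a₁ b₁ a₂ b₂ : PGL2 F}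
    (ha₁ : IsSplit a₁) (hb₁ : IsSplit b₁) (hab₁ : IsSplit (a₁ * b₁))
    (ha₂ : ¬ IsSplit a₂) (hb₂ : ¬ IsSplit b₂) (hab₂ : ¬ IsSplit (a₂ * b₂))
    (h₁ : Subgroup.closure ({a₁, b₁} : Set (PGL2 F)) = ⊤)
    (h₂ : Subgroup.closure ({a₂, b₂} : Set (PGL2 F)) = ⊤) :
    IsUnmixedBeauville a₁ b₁ (a₁ * b₁)⁻¹ a₂ b₂ (a₂ * b₂)⁻¹ :=
  ⟨mul_inv_cancel _, mul_inv_cancel _, h₁, h₂,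
    sigma3_inter_sigma3_eq_one ha₁ hb₁ hab₁.inv ha₂ hb₂ fun h => hab₂ (by simpa using h.inv)⟩

end DiscriminantClass

section Generation

variable {F : Type*} [Field F]

/-- The matrices underlying the elements of a subgroup of `GL₂(F)`. -/
def matricesOf (H : Subgroup (GL (Fin 2) F)) : Submonoid (Matrix (Fin 2) (Fin 2) F) :=
  H.toSubmonoid.map (Units.coeHom _)

variable {H : Subgroup (GL (Fin 2) F)}

lemma val_mem_matricesOf {g : GL (Fin 2) F} : g.val ∈ matricesOf H ↔ g ∈ H := by
  refine ⟨?_, fun h => ⟨g, h, rfl⟩⟩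
  rintro ⟨k, hk, h⟩
  rwa [← Units.ext h]

lemma matricesOf_cancel_left {X Y : Matrix (Fin 2) (Fin 2) F} (hX : X ∈ matricesOf H)
    (hXY : X * Y ∈ matricesOf H) : Y ∈ matricesOf H := by
  obtain ⟨g, hg, rfl⟩ := hX
  obtain ⟨k, hk, h⟩ := hXY
  refine ⟨g⁻¹ * k, H.mul_mem (H.inv_mem hg) hk, ?_⟩
  simp only [Units.coeHom_apply] at h ⊢
  rw [Units.val_mul, h, ← mul_assoc, Units.inv_mul, one_mul]

lemma matricesOf_cancel_right {X Y : Matrix (Fin 2) (Fin 2) F} (hY : Y ∈ matricesOf H)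
    (hXY : X * Y ∈ matricesOf H) : X ∈ matricesOf H := by
  obtain ⟨g, hg, rfl⟩ := hY
  obtain ⟨k, hk, h⟩ := hXY
  refine ⟨k * g⁻¹, H.mul_mem hk (H.inv_mem hg), ?_⟩
  simp only [Units.coeHom_apply] at h ⊢
  rw [Units.val_mul, h, mul_assoc, Units.mul_inv, mul_one]

lemma smul_one_mem_matricesOf (hH : Subgroup.center (GL (Fin 2) F) ≤ H) {c : F} (hc : c ≠ 0) :
    c • (1 : Matrix (Fin 2) (Fin 2) F) ∈ matricesOf H := by
  refine ⟨Matrix.GeneralLinearGroup.mkOfDetNeZero (c • 1) (by simpa using hc), hH ?_, rfl⟩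
  rw [Matrix.GeneralLinearGroup.mem_center_iff_val_mem_range_scalar]
  exact ⟨c, by rw [Matrix.scalar_apply, ← Matrix.smul_one_eq_diagonal]; rfl⟩

lemma of_smul_mem_matricesOf (hH : Subgroup.center (GL (Fin 2) F) ≤ H) {c : F} (hc : c ≠ 0)
    {X : Matrix (Fin 2) (Fin 2) F} (hX : c • X ∈ matricesOf H) : X ∈ matricesOf H :=
  matricesOf_cancel_left (smul_one_mem_matricesOf hH hc) (by simpa using hX)

lemma smul_mem_matricesOf (hH : Subgroup.center (GL (Fin 2) F) ≤ H) {c : F} (hc : c ≠ 0)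
    {X : Matrix (Fin 2) (Fin 2) F} (hX : X ∈ matricesOf H) : c • X ∈ matricesOf H := by
  simpa using mul_mem (smul_one_mem_matricesOf hH hc) hX

lemma eq_top_of_unipotent_mem {x y : F} (hx : x ≠ 0) (hy : y ≠ 0)
    (hU : ∀ β : F, !![1, β; 0, 1] ∈ matricesOf H) (hxy : !![0, x; y, 0] ∈ matricesOf H)
    (hdet : ∀ δ : F, δ ≠ 0 → ∃ X ∈ matricesOf H, X.det = δ) : H = ⊤ := by
  have hL (β : F) : !![1, 0; β, 1] ∈ matricesOf H := by
    refine matricesOf_cancel_right hxy ?_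
    have h : !![1, 0; β, 1] * !![0, x; y, 0] = !![0, x; y, 0] * !![1, x * β / y; 0, 1] := by
      ext i j
      fin_cases i <;> fin_cases j <;> simp <;> field_simp
    rw [h]
    exact mul_mem hxy (hU _)
  have hSL' (p q r s : F) (hr : r ≠ 0) (hd : p * s - q * r = 1) :
      !![p, q; r, s] ∈ matricesOf H := by
    have h : !![p, q; r, s] = !![1, (p - 1) / r; 0, 1] * !![1, 0; r, 1] *
        !![1, (s - 1) / r; 0, 1] := by
      ext i j
      fin_cases i <;> fin_cases j <;> simp <;> field_simp <;>
        first | ring1 | linear_combination -hd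
    rw [h]
    exact mul_mem (mul_mem (hU _) (hL _)) (hU _)
  have hSL (p q r s : F) (hd : p * s - q * r = 1) : !![p, q; r, s] ∈ matricesOf H := by
    by_cases hr : r = 0
    · subst hr
      have hp : p ≠ 0 := by rintro rfl; simp at hd
      refine matricesOf_cancel_left (hL 1) ?_
      have h : !![1, 0; 1, 1] * !![p, q; 0, s] = !![p, q; p, q + s] := by
        ext i j
        fin_cases i <;> fin_cases j <;> simp
      rw [h]
      exact hSL' _ _ _ _ hp (by linear_combination hd)
    · exact hSL' _ _ _ _ hr hd
  refine (Subgroup.eq_top_iff' H).2 fun g => ?_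
  obtain ⟨_, ⟨k, hk, rfl⟩, hkd⟩ := hdet g.val.det g.det.ne_zero
  have h : k⁻¹ * g ∈ H := by
    rw [← val_mem_matricesOf, Matrix.eta_fin_two (k⁻¹ * g).val]
    apply hSL
    rw [← Matrix.det_fin_two, Units.val_mul, Matrix.det_mul, ← hkd, ← Matrix.det_mul]
    simp
  simpa using H.mul_mem hk h

lemma closure_eq_top_of_forall {a b : GL (Fin 2) F}
    (h : ∀ H : Subgroup (GL (Fin 2) F), Subgroup.center (GL (Fin 2) F) ≤ H →
      a.val ∈ matricesOf H → b.val ∈ matricesOf H → H = ⊤) :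
    Subgroup.closure ({(a : PGL2 F), (b : PGL2 F)} : Set (PGL2 F)) = ⊤ := by
  set K := Subgroup.closure ({(a : PGL2 F), (b : PGL2 F)} : Set (PGL2 F)) with hK
  have hc : K.comap (QuotientGroup.mk' (Subgroup.center (GL (Fin 2) F))) = ⊤ := by
    refine h _ (fun g hg => ?_) (val_mem_matricesOf.2 ?_) (val_mem_matricesOf.2 ?_)
    · rw [Subgroup.mem_comap, QuotientGroup.mk'_apply, (QuotientGroup.eq_one_iff g).2 hg]
      exact K.one_mem
    · exact Subgroup.subset_closure (by simp)
    · exact Subgroup.subset_closure (by simp)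
  rw [Subgroup.eq_top_iff']
  intro x
  induction x using QuotientGroup.induction_on with
  | H g => exact Subgroup.mem_comap.1 (hc ▸ Subgroup.mem_top g)

end Generation

section SplitTriple

variable {F : Type*} [Field F]

lemma exists_split_triple {ζ : Fˣ} (hζ : ∀ x, x ∈ Subgroup.zpowers ζ)
    (h1 : (ζ : F) ≠ 1) (h2 : (ζ : F) ≠ -1) (htwo : (2 : F) ≠ 0) :
    ∃ a b : PGL2 F, IsSplit a ∧ IsSplit b ∧ IsSplit (a * b) ∧
      Subgroup.closure ({a, b} : Set (PGL2 F)) = ⊤ := by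
  have hζ0 : (ζ : F) ≠ 0 := ζ.ne_zero
  have hζ1 : 1 - (ζ : F) ≠ 0 := sub_ne_zero.2 h1.symm
  have hu : 2 * (1 + (ζ : F)) ≠ 0 :=
    mul_ne_zero htwo fun h => h2 (by linear_combination h)
  let D : Fˣ →* GL (Fin 2) F :=
    { toFun := fun x => Matrix.GeneralLinearGroup.mkOfDetNeZero !![1, 0; 0, (x : F)] (by simp)
      map_one' := by ext i j; fin_cases i <;> fin_cases j <;> rfl
      map_mul' := fun x y => by
        ext i j
        fin_cases i <;> fin_cases j <;> simp [Matrix.GeneralLinearGroup.mkOfDetNeZero] }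
  have hD (x : Fˣ) : (D x).val = !![1, 0; 0, (x : F)] := rfl
  let b : GL (Fin 2) F := Matrix.GeneralLinearGroup.mkOfDetNeZero
    !![1 - (ζ : F), 2 * (1 + (ζ : F)); 1, 0] (by simpa using hu)
  have hb : b.val = !![1 - (ζ : F), 2 * (1 + (ζ : F)); 1, 0] := rfl
  refine ⟨D ζ, b, ?_, ?_, ?_, closure_eq_top_of_forall fun H hH ha hbH => ?_⟩
  · rw [isSplit_mk_iff, hD, Matrix.discr_fin_two]
    exact ⟨1 - ζ, by simp [Matrix.trace_fin_two]; ring⟩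
  · rw [isSplit_mk_iff, hb, Matrix.discr_fin_two]
    exact ⟨3 + ζ, by simp [Matrix.trace_fin_two]; ring⟩
  · rw [← QuotientGroup.mk_mul, isSplit_mk_iff, Units.val_mul, hD, hb, Matrix.discr_fin_two]
    exact ⟨1 + 3 * ζ, by simp [Matrix.trace_fin_two]; ring⟩
  rw [hb] at hbH
  have hdiag' (x : F) (hx : x ≠ 0) : !![1, 0; 0, x] ∈ matricesOf H := by
    obtain ⟨k, hk⟩ := hζ (Units.mk0 x hx)
    have h : !![1, 0; 0, x] = (D ζ ^ k).val := by
      rw [← map_zpow, hD]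
      simp only at hk
      rw [hk, Units.val_mk0]
    rw [h]
    exact val_mem_matricesOf.2 (H.zpow_mem (val_mem_matricesOf.1 ha) k)
  have hdiag (x y : F) (hx : x ≠ 0) (hy : y ≠ 0) : !![x, 0; 0, y] ∈ matricesOf H := by
    have h : !![x, 0; 0, y] = x • !![1, 0; 0, y / x] := by
      ext i j
      fin_cases i <;> fin_cases j <;> simp
      field_simp
    rw [h]
    exact smul_mem_matricesOf hH hx (hdiag' _ (div_ne_zero hy hx))
  have hU₁ : !![1, (1 - (ζ : F)) * (1 - (ζ : F)⁻¹) * (ζ : F)⁻¹; 0, 1] ∈ matricesOf H := by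
    refine matricesOf_cancel_right (Y := !![(ζ : F)⁻¹, 0; 0, ζ])
      (hdiag _ _ (inv_ne_zero hζ0) hζ0) (matricesOf_cancel_right hbH ?_)
    have h : !![1, (1 - (ζ : F)) * (1 - (ζ : F)⁻¹) * (ζ : F)⁻¹; 0, 1] *
        !![(ζ : F)⁻¹, 0; 0, ζ] * !![1 - (ζ : F), 2 * (1 + (ζ : F)); 1, 0] =
        !![1, 0; 0, (ζ : F)] * !![1 - (ζ : F), 2 * (1 + (ζ : F)); 1, 0] *
          !![1, 0; 0, (ζ : F)⁻¹] := by
      ext i j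
      fin_cases i <;> fin_cases j <;> simp <;> field_simp
      ring
    rw [h]
    exact mul_mem (mul_mem (hdiag' _ hζ0) hbH) (hdiag' _ (inv_ne_zero hζ0))
  have he : (1 - (ζ : F)) * (1 - (ζ : F)⁻¹) * (ζ : F)⁻¹ ≠ 0 := by
    refine mul_ne_zero (mul_ne_zero hζ1 (sub_ne_zero.2 fun h => h1 ?_)) (inv_ne_zero hζ0)
    exact inv_eq_one.1 h.symm
  generalize (1 - (ζ : F)) * (1 - (ζ : F)⁻¹) * (ζ : F)⁻¹ = ε at hU₁ he
  have hU (β : F) : !![1, β; 0, 1] ∈ matricesOf H := by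
    by_cases hβ : β = 0
    · subst hβ
      exact hdiag' 1 one_ne_zero
    · have hx : β / ε ≠ 0 := div_ne_zero hβ he
      refine matricesOf_cancel_right (hdiag (β / ε) 1 hx one_ne_zero) ?_
      have h : !![1, β; 0, 1] * !![β / ε, 0; 0, 1] = !![β / ε, 0; 0, 1] * !![1, ε; 0, 1] := by
        ext i j
        fin_cases i <;> fin_cases j <;> simp
        field_simp
      rw [h]
      exact mul_mem (hdiag _ _ hx one_ne_zero) hU₁
  refine eq_top_of_unipotent_mem hu one_ne_zero hU ?_ fun δ hδ => ⟨_, hdiag' δ hδ, by simp⟩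
  have h : !![0, 2 * (1 + (ζ : F)); 1, 0] =
      !![1, -(1 - (ζ : F)); 0, 1] * !![1 - (ζ : F), 2 * (1 + (ζ : F)); 1, 0] := by
    ext i j
    fin_cases i <;> fin_cases j <;> simp
  rw [h]
  exact mul_mem (hU _) hbH

end SplitTriple

section NonsplitTriple

variable {F : Type*} [Field F]

lemma not_isSquare_sq_mul {x c : F} (hc : c ≠ 0) (hx : ¬ IsSquare x) : ¬ IsSquare (c ^ 2 * x) := by
  rintro ⟨r, hr⟩
  refine hx ⟨r / c, ?_⟩
  field_simp
  linear_combination hr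

lemma sq_sub_mul_sq_ne_zero {d x y : F} (hd : ¬ IsSquare d) (hxy : x ≠ 0 ∨ y ≠ 0) :
    x ^ 2 - d * y ^ 2 ≠ 0 := by
  intro h
  by_cases hy : y = 0
  · subst hy
    exact hxy.elim (fun hx => hx (by simpa using h)) (fun h => h rfl)
  · refine hd ⟨x / y, ?_⟩
    field_simp
    linear_combination -h

lemma exists_sq_sub_mul_sq_eq [Fintype F] (hF : Odd (Fintype.card F)) {d : F} (hd : d ≠ 0)
    (δ : F) : ∃ x y : F, x ^ 2 - d * y ^ 2 = δ := by
  obtain ⟨x, y, h⟩ := FiniteField.exists_root_sum_quadratic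
    (f := Polynomial.C 1 * Polynomial.X ^ 2 + Polynomial.C 0 * Polynomial.X + Polynomial.C (-δ))
    (g := Polynomial.C (-d) * Polynomial.X ^ 2 + Polynomial.C 0 * Polynomial.X + Polynomial.C 0)
    (Polynomial.degree_quadratic one_ne_zero) (Polynomial.degree_quadratic (neg_ne_zero.2 hd))
    (Nat.odd_iff.1 hF)
  refine ⟨x, y, ?_⟩
  simp at h
  linear_combination h

lemma card_filter_quadratic_le_two [Fintype F] [DecidableEq F] {a b c : F}
    (h : a ≠ 0 ∨ b ≠ 0 ∨ c ≠ 0) :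
    (Finset.univ.filter fun m : F => a * m ^ 2 + b * m + c = 0).card ≤ 2 := by
  set p : Polynomial F :=
    Polynomial.C a * Polynomial.X ^ 2 + Polynomial.C b * Polynomial.X + Polynomial.C c with hp
  have hp0 : p ≠ 0 := by
    intro h0
    have h2 : p.coeff 2 = a := by simp [hp]
    have h1 : p.coeff 1 = b := by simp [hp, Polynomial.coeff_C]
    have h0' : p.coeff 0 = c := by simp [hp]
    rw [h0, Polynomial.coeff_zero] at h2 h1 h0'
    simp [← h2, ← h1, ← h0'] at h
  calc (Finset.univ.filter fun m : F => a * m ^ 2 + b * m + c = 0).card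
      ≤ p.roots.toFinset.card := by
        refine Finset.card_le_card fun m hm => ?_
        rw [Multiset.mem_toFinset, Polynomial.mem_roots hp0, Polynomial.IsRoot.def]
        simpa [hp] using hm
    _ ≤ p.roots.card := Multiset.toFinset_card_le _
    _ ≤ p.natDegree := Polynomial.card_roots' p
    _ ≤ 2 := Polynomial.natDegree_quadratic_le

lemma addSubgroup_eq_top_of_card_le_two_mul [Fintype F] (hF : Odd (Fintype.card F))
    (W : AddSubgroup F) (hW : Fintype.card F ≤ 2 * Nat.card W) : W = ⊤ := by
  rw [← AddSubgroup.index_eq_one]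
  have h := W.card_mul_index
  rw [Nat.card_eq_fintype_card (α := F)] at h
  have hodd : Odd W.index := (Nat.odd_mul.1 (h ▸ hF)).2
  have hpos : 0 < Nat.card W := Nat.card_pos
  have hle : W.index ≤ 2 := by
    by_contra! h3
    nlinarith
  obtain ⟨k, hk⟩ := hodd
  omega

variable {H : Subgroup (GL (Fin 2) F)} {d : F}

/-- A subgroup containing the nonsplit torus of norm form `x² - d y²` and the maps `z ↦ z + y z̄`
and `z ↦ z + ȳ z̄` contains a family of unipotent elements. -/
lemma unipotent_mem_of_torus_mem (hd : ¬ IsSquare d)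
    (hT : ∀ x y : F, x ≠ 0 ∨ y ≠ 0 → !![x, d * y; y, x] ∈ matricesOf H) {y z : F}
    (hρ : ¬ IsSquare (y ^ 2 - d * z ^ 2))
    (hg : !![1 + y, -(d * z); z, 1 - y] ∈ matricesOf H)
    (hg' : !![1 + y, d * z; -z, 1 - y] ∈ matricesOf H) (m : F) :
    !![1, 4 * d * (z * (1 + d * m ^ 2) + 2 * y * m) /
      ((1 - (y ^ 2 - d * z ^ 2)) * (1 - d * m ^ 2)); 0, 1] ∈ matricesOf H := by
  have hρ1 : 1 - (y ^ 2 - d * z ^ 2) ≠ 0 := fun h =>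
    hρ ⟨1, by linear_combination -h⟩
  have hm : 1 - d * m ^ 2 ≠ 0 := by
    simpa using sq_sub_mul_sq_ne_zero (x := 1) (y := m) hd (Or.inl one_ne_zero)
  have hw : 1 + y + d * m * z ≠ 0 ∨ -m + z + y * m ≠ 0 := by
    by_contra! h
    refine mul_ne_zero hρ1 hm ?_
    linear_combination (2 - (1 + y + d * m * z)) * h.1 + d * (-m + z + y * m + 2 * m) * h.2
  have hw' : 1 + y + d * m * z ≠ 0 ∨ -(-m + z + y * m) ≠ 0 := by rwa [neg_ne_zero]
  have hc : !![1, d * m; m, 1] ∈ matricesOf H := hT 1 m (Or.inl one_ne_zero)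
  have hc' : !![1, d * -m; -m, 1] ∈ matricesOf H := hT 1 (-m) (Or.inl one_ne_zero)
  refine matricesOf_cancel_right (mul_mem (hT _ _ hw') (mul_mem hg hc')) ?_
  have h : !![1, 4 * d * (z * (1 + d * m ^ 2) + 2 * y * m) /
      ((1 - (y ^ 2 - d * z ^ 2)) * (1 - d * m ^ 2)); 0, 1] *
      (!![1 + y + d * m * z, d * -(-m + z + y * m); -(-m + z + y * m), 1 + y + d * m * z] *
        (!![1 + y, -(d * z); z, 1 - y] * !![1, d * -m; -m, 1])) =
      !![1 + y + d * m * z, d * (-m + z + y * m); -m + z + y * m, 1 + y + d * m * z] *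
        (!![1 + y, d * z; -z, 1 - y] * !![1, d * m; m, 1]) := by
    ext i j
    fin_cases i <;> fin_cases j <;> simp <;> field_simp <;> ring
  rw [h]
  exact mul_mem (hT _ _ hw) (mul_mem hg' hc)

lemma eq_top_of_torus_mem [Fintype F] (hF : Odd (Fintype.card F)) (htwo : (2 : F) ≠ 0)
    (hd : ¬ IsSquare d)
    (hT : ∀ x y : F, x ≠ 0 ∨ y ≠ 0 → !![x, d * y; y, x] ∈ matricesOf H) {y z : F}
    (hρ : ¬ IsSquare (y ^ 2 - d * z ^ 2))
    (hg : !![1 + y, -(d * z); z, 1 - y] ∈ matricesOf H)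
    (hg' : !![1 + y, d * z; -z, 1 - y] ∈ matricesOf H) : H = ⊤ := by
  classical
  have hd0 : d ≠ 0 := by rintro rfl; exact hd IsSquare.zero
  have hρ1 : 1 - (y ^ 2 - d * z ^ 2) ≠ 0 := fun h =>
    hρ ⟨1, by linear_combination -h⟩
  have hadd (β γ : F) : !![1, β; 0, 1] * !![1, γ; 0, 1] = !![1, β + γ; 0, 1] := by
    ext i j
    fin_cases i <;> fin_cases j <;> simp [add_comm]
  have h1 : !![1, (0 : F); 0, 1] ∈ matricesOf H := by
    rw [← Matrix.one_fin_two]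
    exact one_mem _
  let W : AddSubgroup F :=
    { carrier := {β | !![1, β; 0, 1] ∈ matricesOf H}
      zero_mem' := h1
      add_mem' := fun {β γ} hβ hγ => by
        rw [Set.mem_ofPred_eq, ← hadd]
        exact mul_mem hβ hγ
      neg_mem' := fun {β} hβ => by
        refine matricesOf_cancel_left hβ ?_
        rw [hadd, add_neg_cancel]
        exact h1 }
  let f : F → F := fun m => 4 * d * (z * (1 + d * m ^ 2) + 2 * y * m) /
      ((1 - (y ^ 2 - d * z ^ 2)) * (1 - d * m ^ 2))
  have hf (m : F) : f m ∈ W := unipotent_mem_of_torus_mem hd hT hρ hg hg' m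
  have hfib (s : F) : (Finset.univ.filter fun m : F => f m = s).card ≤ 2 := by
    set t := s * (1 - (y ^ 2 - d * z ^ 2)) / (4 * d) with ht
    have h4 : (4 : F) ≠ 0 := by
      rw [show (4 : F) = 2 * 2 by norm_num]
      exact mul_ne_zero htwo htwo
    refine le_trans (Finset.card_le_card fun m hm => ?_)
      (card_filter_quadratic_le_two (a := d * (z + t)) (b := 2 * y) (c := z - t) ?_)
    · have hm0 : 1 - d * m ^ 2 ≠ 0 := by
        simpa using sq_sub_mul_sq_ne_zero (x := 1) (y := m) hd (Or.inl one_ne_zero)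
      simp only [Finset.mem_filter, Finset.mem_univ, true_and] at hm ⊢
      simp only [ht, ← hm, f]
      field_simp
      ring
    · by_contra! h
      obtain ⟨ha, hb, hc⟩ := h
      have hy : y = 0 := (mul_eq_zero.1 hb).resolve_left htwo
      have hz : z = 0 := by
        have hzt : z + t = 0 := (mul_eq_zero.1 ha).resolve_left hd0
        refine (mul_eq_zero.1 (?_ : 2 * z = 0)).resolve_left htwo
        linear_combination hzt + hc
      exact hρ ⟨0, by simp [hy, hz]⟩
  have hW : W = ⊤ := by
    refine addSubgroup_eq_top_of_card_le_two_mul hF W ?_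
    calc Fintype.card F = (Finset.univ : Finset F).card := rfl
      _ ≤ 2 * (Finset.univ.image f).card :=
        Finset.card_le_mul_card_image _ _ fun s _ => hfib s
      _ ≤ 2 * Nat.card W := by
        refine Nat.mul_le_mul_left 2 ?_
        rw [← Set.ncard_coe_finset]
        refine Set.ncard_le_ncard ?_ (Set.toFinite (W : Set F))
        intro s hs
        obtain ⟨m, -, rfl⟩ := Finset.mem_image.1 hs
        exact hf m
  have hU (β : F) : !![1, β; 0, 1] ∈ matricesOf H := by
    have : β ∈ W := hW ▸ AddSubgroup.mem_top β
    exact this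
  refine eq_top_of_unipotent_mem hd0 one_ne_zero hU ?_ fun δ hδ => ?_
  · simpa using hT 0 1 (Or.inr one_ne_zero)
  · obtain ⟨x, w, h⟩ := exists_sq_sub_mul_sq_eq hF hd0 δ
    refine ⟨_, hT x w ?_, by rw [Matrix.det_fin_two_of, ← h]; ring⟩
    by_contra! h0
    simp [h0.1, h0.2] at h
    exact hδ h.symm

/-- The regular representation of `F[√d]`. -/
def quadraticAlgebraToMatrix (d : F) :
    QuadraticAlgebra F d 0 →* Matrix (Fin 2) (Fin 2) F where
  toFun z := !![z.re, d * z.im; z.im, z.re]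
  map_one' := by
    ext i j
    fin_cases i <;> fin_cases j <;> simp [QuadraticAlgebra.re_one, QuadraticAlgebra.im_one]
  map_mul' z w := by
    ext i j
    fin_cases i <;> fin_cases j <;> simp <;> ring

lemma exists_nonsplit_torus_generator [Finite F] (hd : ¬ IsSquare d) :
    ∃ g : GL (Fin 2) F, ∃ x y : F, g.val = !![x, d * y; y, x] ∧
      ∀ u v : F, u ≠ 0 ∨ v ≠ 0 → ∃ k : ℤ, (g ^ k).val = !![u, d * v; v, u] := by
  have : Fact (∀ r : F, r ^ 2 ≠ d + 0 * r) :=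
    ⟨fun r h => hd ⟨r, by linear_combination -h⟩⟩
  have : Finite (QuadraticAlgebra F d 0) := Finite.of_equiv _ (QuadraticAlgebra.equivProd d 0).symm
  obtain ⟨κ, hκ⟩ := IsCyclic.exists_generator (α := (QuadraticAlgebra F d 0)ˣ)
  refine ⟨Units.map (quadraticAlgebraToMatrix d) κ, κ.val.re, κ.val.im, rfl, fun u v huv => ?_⟩
  have h0 : (⟨u, v⟩ : QuadraticAlgebra F d 0) ≠ 0 := by
    rw [Ne, QuadraticAlgebra.ext_iff]
    rintro ⟨rfl, rfl⟩
    simp at huv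
  obtain ⟨k, hk⟩ := hκ (Units.mk0 _ h0)
  refine ⟨k, ?_⟩
  simp only at hk
  rw [← map_zpow, hk]
  rfl

lemma exists_nonsplit_triple [Fintype F] (hF : Odd (Fintype.card F)) (htwo : (2 : F) ≠ 0)
    (hd : ¬ IsSquare d) (hd1 : d ≠ -1) :
    ∃ a b : PGL2 F, ¬ IsSplit a ∧ ¬ IsSplit b ∧ ¬ IsSplit (a * b) ∧
      Subgroup.closure ({a, b} : Set (PGL2 F)) = ⊤ := by
  have hd0 : d ≠ 0 := by rintro rfl; exact hd IsSquare.zero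
  obtain ⟨A, x, y, hA, hgen⟩ := exists_nonsplit_torus_generator hd
  set n := x ^ 2 - d * y ^ 2 with hn
  have hdetA : A.val.det = n := by rw [hA, Matrix.det_fin_two_of]; ring
  have hnsq : ¬ IsSquare n := by
    rintro ⟨r, hr⟩
    obtain ⟨u, v, huv⟩ := exists_sq_sub_mul_sq_eq hF hd0 d
    obtain ⟨k, hk⟩ := hgen u v (by
      by_contra! h0
      simp [h0.1, h0.2] at huv
      exact hd0 huv.symm)
    refine hd ⟨r ^ k, ?_⟩
    have h : (A ^ k).val.det = n ^ k := by
      have := congrArg Units.val (map_zpow Matrix.GeneralLinearGroup.det A k)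
      rw [Units.val_zpow_eq_zpow_val] at this
      rw [← hdetA]
      exact this
    rw [hk, hr, mul_zpow, Matrix.det_fin_two_of] at h
    linear_combination h - huv
  have hn0 : n ≠ 0 := by intro h; exact hnsq (h ▸ IsSquare.zero)
  have hy : y ≠ 0 := by
    rintro rfl
    exact hnsq ⟨x, by rw [hn]; ring⟩
  have hd1' : 1 - d ≠ 0 := fun h => hd ⟨1, by linear_combination -h⟩
  have hd2' : 1 + d ≠ 0 := fun h => hd1 (by linear_combination h)
  set l := -((1 - d) / (2 * d)) / y with hl
  have hly : l * y = -((1 - d) / (2 * d)) := by rw [hl]; field_simp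
  have hl0 : l ≠ 0 := by
    rw [hl]
    exact div_ne_zero (neg_ne_zero.2 (div_ne_zero hd1' (mul_ne_zero htwo hd0))) hy
  have hB0 : (!![l * x + 1, -(d * (l * y)); -(l * y), l * x - 1]).det ≠ 0 := by
    rw [Matrix.det_fin_two_of]
    intro h
    refine hnsq ⟨l⁻¹, ?_⟩
    rw [hn]
    field_simp
    linear_combination h
  let B := Matrix.GeneralLinearGroup.mkOfDetNeZero _ hB0
  have hB : B.val = !![l * x + 1, -(d * (l * y)); -(l * y), l * x - 1] := rfl
  have hAB : A.val * B.val = !![l * n + x, -(d * y); y, l * n - x] := by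
    rw [hA, hB]
    ext i j
    fin_cases i <;> fin_cases j <;> simp <;> ring
  have hBA : B.val * A.val = !![l * n + x, d * y; -y, l * n - x] := by
    rw [hA, hB]
    ext i j
    fin_cases i <;> fin_cases j <;> simp <;> ring
  refine ⟨A, B, ?_, ?_, ?_, closure_eq_top_of_forall fun H hH ha hb => ?_⟩
  · rw [isSplit_mk_iff, hA, Matrix.discr_fin_two, Matrix.trace_fin_two_of, Matrix.det_fin_two_of]
    convert not_isSquare_sq_mul (mul_ne_zero htwo hy) hd using 2
    ring
  · rw [isSplit_mk_iff, hB, Matrix.discr_fin_two, Matrix.trace_fin_two_of, Matrix.det_fin_two_of]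
    convert not_isSquare_sq_mul (div_ne_zero hd2' hd0) hd using 2
    rw [hly]
    field_simp
    ring
  · rw [← QuotientGroup.mk_mul, isSplit_mk_iff, Units.val_mul, hAB, Matrix.discr_fin_two,
      Matrix.trace_fin_two_of, Matrix.det_fin_two_of]
    convert not_isSquare_sq_mul htwo hnsq using 2
    ring
  · have hln : l * n ≠ 0 := mul_ne_zero hl0 hn0
    refine eq_top_of_torus_mem (y := x / (l * n)) (z := y / (l * n)) hF htwo hd
      (fun u v huv => ?_) ?_ ?_ ?_
    · obtain ⟨k, hk⟩ := hgen u v huv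
      rw [← hk]
      exact val_mem_matricesOf.2 (H.zpow_mem (val_mem_matricesOf.1 ha) k)
    · convert not_isSquare_sq_mul (inv_ne_zero hln) hnsq using 2
      rw [hn]
      ring
    · refine of_smul_mem_matricesOf hH hln ?_
      have h := mul_mem ha hb
      rw [hAB] at h
      convert h using 1
      ext i j
      fin_cases i <;> fin_cases j <;> simp <;> field_simp
    · refine of_smul_mem_matricesOf hH hln ?_
      have h := mul_mem hb ha
      rw [hBA] at h
      convert h using 1
      ext i j
      fin_cases i <;> fin_cases j <;> simp <;> field_simp

end NonsplitTriple

/-- Every group `PGL₂(q)` with `q ≥ 5` an odd prime power admits an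
unmixed Beauville structure. -/
theorem beauville_exists_PGL2 (p e : ℕ) (hp : p.Prime) (hodd : Odd p) (he : 0 < e)
    (hq : 5 ≤ p ^ e)
    (F : Type*) [Field F] [Fintype F] (hF : Fintype.card F = p ^ e) :
    ∃ a₁ b₁ c₁ a₂ b₂ c₂ : PGL2 F, IsUnmixedBeauville a₁ b₁ c₁ a₂ b₂ c₂ := by
  have hFodd : Odd (Fintype.card F) := hF ▸ hodd.pow
  have hchar : ringChar F ≠ 2 := by
    intro h
    exact Nat.not_even_iff_odd.2 hFodd (FiniteField.even_card_iff_char_two.1 h |> Nat.even_iff.2)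
  have htwo : (2 : F) ≠ 0 := Ring.two_ne_zero hchar
  obtain ⟨ζ, hζ⟩ := IsCyclic.exists_generator (α := Fˣ)
  have hζsq : ζ ^ 2 ≠ 1 := by
    intro h
    have h₁ : orderOf ζ ≤ 2 := orderOf_le_of_pow_eq_one two_pos h
    rw [orderOf_eq_card_of_forall_mem_zpowers hζ, Nat.card_units, Nat.card_eq_fintype_card] at h₁
    omega
  have h1 : (ζ : F) ≠ 1 := fun h => hζsq (Units.ext (by simp [h]))
  have h2 : (ζ : F) ≠ -1 := fun h => hζsq (Units.ext (by simp [h]))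
  have hns : ¬ IsSquare (ζ : F) := by
    rintro ⟨r, hr⟩
    obtain ⟨s, hs⟩ := FiniteField.exists_nonsquare hchar
    have hs0 : s ≠ 0 := by rintro rfl; exact hs IsSquare.zero
    obtain ⟨k, hk⟩ := hζ (Units.mk0 s hs0)
    refine hs ⟨r ^ k, ?_⟩
    have h := congrArg Units.val hk
    simp only [Units.val_zpow_eq_zpow_val, Units.val_mk0] at h
    rw [← h, hr, mul_zpow]
  obtain ⟨a₁, b₁, ha₁, hb₁, hab₁, hc₁⟩ := exists_split_triple hζ h1 h2 htwo
  obtain ⟨a₂, b₂, ha₂, hb₂, hab₂, hc₂⟩ := exists_nonsplit_triple hFodd htwo hns h2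
  exact ⟨_, _, _, _, _, _,
    isUnmixedBeauville_of_isSplit ha₁ hb₁ hab₁ ha₂ hb₂ hab₂ hc₁ hc₂⟩
end
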